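/- arXiv:2107.13658 — 2 statements merged into one kernel-verified Lean document; each statement's English description precedes it below -/
import Mathlib

section
/- Every upward planar 3-tree admits a linear extension whose maximum twist size is at most 5. -/
/-- The vertex set of a directed edge set. -/
def verts (E : Finset (ℕ × ℕ)) : Finset ℕ := E.image Prod.fst ∪ E.image Prod.snd

/-- Two directed edges cross with respect to a vertex order `f`
(the order places vertex `v` at position `f v`). -/
def Crosses (f : ℕ → ℕ) (e e' : ℕ × ℕ) : Prop :=
  (f e.1 < f e'.1 ∧ f e'.1 < f e.2 ∧ f e.2 < f e'.2) ∨
  (f e'.1 < f e.1 ∧ f e.1 < f e'.2 ∧ f e'.2 < f e.2)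

/-- `f` is (an injective position function representing) a linear extension of `E`. -/
def LinExt (E : Finset (ℕ × ℕ)) (f : ℕ → ℕ) : Prop :=
  Function.Injective f ∧ ∀ e ∈ E, f e.1 < f e.2

/-- The edges `(s i, t i)` form a `k`-twist under `f`:
`s 0 < … < s (k-1) < t 0 < … < t (k-1)`. -/
def IsTwist (E : Finset (ℕ × ℕ)) (f : ℕ → ℕ) (k : ℕ) (s t : Fin k → ℕ) : Prop :=
  (∀ i, (s i, t i) ∈ E) ∧ StrictMono (f ∘ s) ∧ StrictMono (f ∘ t) ∧
    ∀ i j, f (s i) < f (t j)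

/-- The maximum twist size of `E` under `f` is at most `k`. -/
def TwistLE (E : Finset (ℕ × ℕ)) (f : ℕ → ℕ) (k : ℕ) : Prop :=
  ∀ m, ∀ s t : Fin m → ℕ, IsTwist E f m s t → m ≤ k

/-- `c` assigns edges to stacks: edges in the same stack never cross. -/
def ValidStacks (E : Finset (ℕ × ℕ)) (f : ℕ → ℕ) (c : ℕ × ℕ → ℕ) : Prop :=
  ∀ e ∈ E, ∀ e' ∈ E, c e = c e' → ¬ Crosses f e e'

/-- `E` admits a `k`-stack layout: a linear extension together with a
partition of the edges into `k` stacks of pairwise non-crossing edges. -/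
def HasStackLayout (E : Finset (ℕ × ℕ)) (k : ℕ) : Prop :=
  ∃ f c, LinExt E f ∧ (∀ e ∈ E, c e < k) ∧ ValidStacks E f c

/-- Construction of upward planar 3-trees.  `UP3TBuild E F` means the DAG `E`
is constructible with `F` the set of currently subdividable faces; a face is
recorded as a triple `(a,b,c)` with `(a,b),(b,c),(a,c) ∈ E`.  A step inserts a
fresh vertex `x` into a face `(a,b,c)`, adds the edges `(a,x),(x,c)` together
with either `(x,b)` or `(b,x)`, and replaces the face by the three new ones. -/
inductive UP3TBuild : Finset (ℕ × ℕ) → Finset (ℕ × ℕ × ℕ) → Prop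
  | base (s m t : ℕ) (h1 : s ≠ m) (h2 : m ≠ t) (h3 : s ≠ t) :
      UP3TBuild {(s, m), (m, t), (s, t)} {(s, m, t)}
  | insertBefore (E : Finset (ℕ × ℕ)) (F : Finset (ℕ × ℕ × ℕ)) (a b c x : ℕ)
      (hE : UP3TBuild E F) (hF : (a, b, c) ∈ F) (hx : x ∉ verts E) :
      UP3TBuild (insert (a, x) (insert (x, b) (insert (x, c) E)))
        (insert (a, x, b) (insert (x, b, c) (insert (a, x, c) (F.erase (a, b, c)))))
  | insertAfter (E : Finset (ℕ × ℕ)) (F : Finset (ℕ × ℕ × ℕ)) (a b c x : ℕ)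
      (hE : UP3TBuild E F) (hF : (a, b, c) ∈ F) (hx : x ∉ verts E) :
      UP3TBuild (insert (a, x) (insert (b, x) (insert (x, c) E)))
        (insert (a, b, x) (insert (b, x, c) (insert (a, x, c) (F.erase (a, b, c)))))

/-- An upward planar 3-tree. -/
def IsUpwardPlanar3Tree (E : Finset (ℕ × ℕ)) : Prop := ∃ F, UP3TBuild E F

/-- A set of edges which is a twist with respect to the vertex positions `f`. -/
def TwistSet (f : ℕ → ℤ) (Q : Finset (ℕ × ℕ)) : Prop :=
  ∀ e ∈ Q, ∀ e' ∈ Q, f e.1 < f e'.2 ∧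
    (e = e' ∨ (f e.1 < f e'.1 ∧ f e.2 < f e'.2) ∨ (f e'.1 < f e.1 ∧ f e'.2 < f e.2))

namespace TwistSet

variable {f : ℕ → ℤ} {Q Q' : Finset (ℕ × ℕ)}

theorem mono (h : TwistSet f Q) (hQ : Q' ⊆ Q) : TwistSet f Q' :=
  fun e he e' he' => h e (hQ he) e' (hQ he')

theorem swap (h : TwistSet f Q) : TwistSet (fun v => -f v) (Q.image Prod.swap) := by
  intro e he e' he'
  obtain ⟨d, hd, rfl⟩ := Finset.mem_image.1 he
  obtain ⟨d', hd', rfl⟩ := Finset.mem_image.1 he'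
  have h1 := h d hd d' hd'
  have h2 := h d' hd' d hd
  refine ⟨by simpa using h2.1, ?_⟩
  rcases h1.2 with h | h | h
  · exact Or.inl (h ▸ rfl)
  · right; right; simpa using h.symm
  · right; left; simpa using h.symm

/-- A twist whose edges all start in `A` or end in `B` has at most `|A| + |B|` edges. -/
theorem card_le_of_cover (h : TwistSet f Q) (A B : List ℕ)
    (hQ : ∀ e ∈ Q, e.1 ∈ A ∨ e.2 ∈ B) : Q.card ≤ A.length + B.length := by
  classical
  have h1 : (Q.filter fun e => e.1 ∈ A).card ≤ A.length := by
    refine le_trans ?_ A.toFinset_card_le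
    refine Finset.card_le_card_of_injOn Prod.fst (by intro e he; simp_all) ?_
    intro e he e' he' hee
    have := h e (by simp_all) e' (by simp_all)
    rcases this.2 with h | h | h
    · exact h
    · rw [hee] at h; omega
    · rw [hee] at h; omega
  have h2 : (Q.filter fun e => e.2 ∈ B).card ≤ B.length := by
    refine le_trans ?_ B.toFinset_card_le
    refine Finset.card_le_card_of_injOn Prod.snd (by intro e he; simp_all) ?_
    intro e he e' he' hee
    have := h e (by simp_all) e' (by simp_all)
    rcases this.2 with h | h | h
    · exact h
    · rw [hee] at h; omega
    · rw [hee] at h; omega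
  calc Q.card ≤ ((Q.filter fun e => e.1 ∈ A) ∪ (Q.filter fun e => e.2 ∈ B)).card := by
        refine Finset.card_le_card fun e he => ?_
        have := hQ e he
        simp_all
    _ ≤ _ := (Finset.card_union_le _ _).trans (by omega)

/-- A twist has at most one edge incident to a given vertex. -/
theorem card_incident_le_one (h : TwistSet f Q) (x : ℕ) (hQ : ∀ e ∈ Q, e.1 = x ∨ e.2 = x) :
    Q.card ≤ 1 := by
  rw [Finset.card_le_one]
  intro e he e' he'
  have h1 := h e he e' he'
  have h2 := h e' he' e he
  rcases hQ e he with h3 | h3 <;> rcases hQ e' he' with h4 | h4 <;> rw [h3, h4] at h1 h2 <;> grind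

end TwistSet

/-- The recursive subdivision of a face of an upward planar 3-tree: either the face is not
subdivided, or a vertex `x` is inserted before or after the middle vertex of the face.  For a
face `(a, b, c)` the three subtrees describe the faces `(a, x, b)`, `(a, x, c)`, `(x, b, c)` in
the case `before`, and `(b, x, c)`, `(a, x, c)`, `(a, b, x)` in the case `after`. -/
inductive FaceTree : Type
  | leaf : FaceTree
  | before (x : ℕ) (t₁ t₂ t₃ : FaceTree) : FaceTree
  | after (x : ℕ) (t₁ t₂ t₃ : FaceTree) : FaceTree

namespace FaceTree

/-- The inner vertices placed to the left and to the right of the middle vertex of the face. -/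
def sides : FaceTree → List ℕ × List ℕ
  | leaf => ([], [])
  | before x t₁ t₂ t₃ =>
    ((sides t₁).1 ++ ((sides t₂).1 ++ x :: ((sides t₂).2 ++ (sides t₁).2)) ++ (sides t₃).1,
      (sides t₃).2)
  | after x t₁ t₂ t₃ =>
    ((sides t₃).1,
      (sides t₃).2 ++ ((sides t₁).1 ++ ((sides t₂).1 ++ x :: ((sides t₂).2 ++ (sides t₁).2))))

/-- The inner vertices placed to the left of the middle vertex. -/
def left (t : FaceTree) : List ℕ := t.sides.1

/-- The inner vertices placed to the right of the middle vertex. -/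
def right (t : FaceTree) : List ℕ := t.sides.2

/-- The interval occupied by a vertex `x` together with the two faces created with middle `x`. -/
def block (x : ℕ) (t₁ t₂ : FaceTree) : List ℕ :=
  t₁.left ++ (t₂.left ++ x :: (t₂.right ++ t₁.right))

@[simp] theorem left_leaf : left leaf = [] := rfl
@[simp] theorem right_leaf : right leaf = [] := rfl
@[simp] theorem left_before (x : ℕ) (t₁ t₂ t₃ : FaceTree) :
    left (before x t₁ t₂ t₃) = block x t₁ t₂ ++ t₃.left := rfl
@[simp] theorem right_before (x : ℕ) (t₁ t₂ t₃ : FaceTree) :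
    right (before x t₁ t₂ t₃) = t₃.right := rfl
@[simp] theorem left_after (x : ℕ) (t₁ t₂ t₃ : FaceTree) :
    left (after x t₁ t₂ t₃) = t₃.left := rfl
@[simp] theorem right_after (x : ℕ) (t₁ t₂ t₃ : FaceTree) :
    right (after x t₁ t₂ t₃) = t₃.right ++ block x t₁ t₂ := rfl

/-- The edges added inside the face `(a, b, c)`. -/
def edges : FaceTree → ℕ → ℕ → ℕ → Finset (ℕ × ℕ)
  | leaf, _, _, _ => ∅
  | before x t₁ t₂ t₃, a, b, c =>
    {(a, x), (x, b), (x, c)} ∪ (edges t₁ a x b ∪ (edges t₂ a x c ∪ edges t₃ x b c))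
  | after x t₁ t₂ t₃, a, b, c =>
    {(a, x), (b, x), (x, c)} ∪ (edges t₁ b x c ∪ (edges t₂ a x c ∪ edges t₃ a b x))

/-- The faces obtained from the face `(a, b, c)`. -/
def faces : FaceTree → ℕ → ℕ → ℕ → Finset (ℕ × ℕ × ℕ)
  | leaf, a, b, c => {(a, b, c)}
  | before x t₁ t₂ t₃, a, b, c => faces t₁ a x b ∪ (faces t₂ a x c ∪ faces t₃ x b c)
  | after x t₁ t₂ t₃, a, b, c => faces t₁ b x c ∪ (faces t₂ a x c ∪ faces t₃ a b x)

/-- The upside-down reflection of a subdivision. -/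
def mirror : FaceTree → FaceTree
  | leaf => leaf
  | before x t₁ t₂ t₃ => after x (mirror t₁) (mirror t₂) (mirror t₃)
  | after x t₁ t₂ t₃ => before x (mirror t₁) (mirror t₂) (mirror t₃)

theorem mirror_mirror (t : FaceTree) : t.mirror.mirror = t := by
  induction t <;> simp_all [mirror]

theorem mirror_sides (t : FaceTree) :
    t.mirror.left = t.right.reverse ∧ t.mirror.right = t.left.reverse := by
  induction t <;> simp_all [mirror, block]

theorem mem_edges_mirror (t : FaceTree) (a b c : ℕ) (e : ℕ × ℕ) :
    e ∈ t.mirror.edges c b a ↔ e.swap ∈ t.edges a b c := by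
  obtain ⟨u, v⟩ := e
  induction t generalizing a b c with
  | leaf => simp [mirror, edges]
  | before x t₁ t₂ t₃ h₁ h₂ h₃ | after x t₁ t₂ t₃ h₁ h₂ h₃ =>
    simp only [mirror, edges, Finset.mem_union, Finset.mem_insert, Finset.mem_singleton, h₁, h₂,
      h₃, Prod.swap_prod_mk, Prod.mk.injEq]
    tauto

theorem endpoints_mem {t : FaceTree} {a b c : ℕ} {e : ℕ × ℕ} (he : e ∈ t.edges a b c) :
    (e.1 = a ∨ e.1 ∈ t.left ∨ e.1 = b ∨ e.1 ∈ t.right) ∧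
      (e.2 ∈ t.left ∨ e.2 = b ∨ e.2 ∈ t.right ∨ e.2 = c) := by
  obtain ⟨u, v⟩ := e
  induction t generalizing a b c with
  | leaf => simp [edges] at he
  | before x t₁ t₂ t₃ h₁ h₂ h₃ | after x t₁ t₂ t₃ h₁ h₂ h₃ =>
    simp only [edges, Finset.mem_union, Finset.mem_insert, Finset.mem_singleton,
      Prod.mk.injEq] at he
    simp only [left_before, right_before, left_after, right_after, block, List.mem_append,
      List.mem_cons]
    rcases he with (he | he | he) | he | he | he
    · simp [he]
    · simp [he]
    · simp [he]
    · have := h₁ he; grind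
    · have := h₂ he; grind
    · have := h₃ he; grind

/-- The positions `f` are compatible with the layout of the subdivided face `(a, b, c)`. -/
def Ordered (f : ℕ → ℤ) (t : FaceTree) (a b c : ℕ) : Prop :=
  (a :: (t.left ++ b :: (t.right ++ [c]))).Pairwise fun u v => f u < f v

theorem Ordered.mirror {f : ℕ → ℤ} {t : FaceTree} {a b c : ℕ} (h : Ordered f t a b c) :
    Ordered (fun v => -f v) t.mirror c b a := by
  unfold Ordered at *
  rw [← List.pairwise_reverse]
  simpa [mirror_sides] using h


theorem Ordered.before {f : ℕ → ℤ} {x a b c : ℕ} {t₁ t₂ t₃ : FaceTree}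
    (h : Ordered f (before x t₁ t₂ t₃) a b c) :
    (Ordered f t₁ a x b ∧ Ordered f t₂ a x c ∧ Ordered f t₃ x b c) ∧
      (block x t₁ t₂).Pairwise (fun u v => f u < f v) ∧
      (∀ u ∈ block x t₁ t₂, f a < f u ∧ f u < f b ∧ ∀ v ∈ t₃.left, f u < f v) := by
  unfold Ordered at *
  simp only [left_before, right_before, block, List.pairwise_append, List.pairwise_cons,
    List.mem_append, List.mem_cons, List.not_mem_nil, or_false, or_imp, forall_and, forall_eq,
    false_imp_iff, implies_true, List.Pairwise.nil, and_true, true_and] at *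
  simp_all only [and_self, implies_true]

theorem Ordered.after {f : ℕ → ℤ} {x a b c : ℕ} {t₁ t₂ t₃ : FaceTree}
    (h : Ordered f (after x t₁ t₂ t₃) a b c) :
    (Ordered f t₁ b x c ∧ Ordered f t₂ a x c ∧ Ordered f t₃ a b x) ∧
      (block x t₁ t₂).Pairwise (fun u v => f u < f v) ∧
      (∀ u ∈ block x t₁ t₂, f b < f u ∧ f u < f c ∧ ∀ v ∈ t₃.right, f v < f u) := by
  have h' := h.mirror.before
  obtain ⟨⟨h₁, h₂, h₃⟩, h₄, h₅⟩ := h'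
  have h₁ := h₁.mirror
  have h₂ := h₂.mirror
  have h₃ := h₃.mirror
  simp only [mirror_mirror, neg_neg] at h₁ h₂ h₃
  have hb : block x t₁.mirror t₂.mirror = (block x t₁ t₂).reverse := by
    simp [block, mirror_sides]
  rw [hb] at h₄ h₅
  rw [← List.pairwise_reverse]
  refine ⟨⟨h₁, h₂, h₃⟩, ?_, ?_⟩
  · simpa using h₄
  · simpa [mirror_sides, and_left_comm, and_assoc] using h₅

/-- The part of `Ordered` concerning single inner vertices. -/
theorem Ordered.mem {f : ℕ → ℤ} {t : FaceTree} {a b c : ℕ} (h : Ordered f t a b c) :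
    f a < f b ∧ f b < f c ∧ (∀ u ∈ t.left, f a < f u ∧ f u < f b) ∧
      (∀ u ∈ t.right, f b < f u ∧ f u < f c) := by
  unfold Ordered at *
  simp only [List.pairwise_append, List.pairwise_cons, List.mem_append, List.mem_cons] at h
  grind

theorem Ordered.lt_of_mem_edges {f : ℕ → ℤ} {t : FaceTree} {a b c : ℕ} (h : Ordered f t a b c)
    {e : ℕ × ℕ} (he : e ∈ t.edges a b c) : f e.1 < f e.2 := by
  induction t generalizing a b c with
  | leaf => simp [edges] at he
  | before x t₁ t₂ t₃ h₁ h₂ h₃ =>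
    obtain ⟨⟨o₁, o₂, o₃⟩, -, -⟩ := h.before
    have := o₁.mem
    have := o₂.mem
    simp only [edges, Finset.mem_union, Finset.mem_insert, Finset.mem_singleton] at he
    rcases he with (rfl | rfl | rfl) | he | he | he
    · tauto
    · tauto
    · tauto
    · exact h₁ o₁ he
    · exact h₂ o₂ he
    · exact h₃ o₃ he
  | after x t₁ t₂ t₃ h₁ h₂ h₃ =>
    obtain ⟨⟨o₁, o₂, o₃⟩, -, -⟩ := h.after
    have := o₁.mem
    have := o₂.mem
    simp only [edges, Finset.mem_union, Finset.mem_insert, Finset.mem_singleton] at he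
    rcases he with (rfl | rfl | rfl) | he | he | he
    · tauto
    · tauto
    · tauto
    · exact h₁ o₁ he
    · exact h₂ o₂ he
    · exact h₃ o₃ he

/-- The edges passing over the middle vertex of a face contain no twist of size three. -/
theorem card_spanning_le_two {f : ℕ → ℤ} {t : FaceTree} {a b c : ℕ} (h : Ordered f t a b c)
    {Q : Finset (ℕ × ℕ)} (hQ : TwistSet f Q)
    (hE : ∀ e ∈ Q, e ∈ t.edges a b c ∧ f e.1 < f b ∧ f b < f e.2) : Q.card ≤ 2 := by
  induction t generalizing a b c with
  | leaf =>
    rw [Finset.eq_empty_of_forall_notMem (s := Q) fun e he => by simpa [edges] using (hE e he).1]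
    simp
  | before x t₁ t₂ t₃ h₁ h₂ h₃ =>
    obtain ⟨⟨o₁, o₂, o₃⟩, o₄, o₅⟩ := h.before
    have m₁ := o₁.mem
    have m₂ := o₂.mem
    have m₃ := o₃.mem
    have key : ∀ e ∈ Q, (e.2 = c ∧ f e.1 ≤ f x) ∨ (e.2 = c ∧ e.1 ∈ block x t₁ t₂) ∨
        e ∈ t₃.edges x b c := by
      intro e he
      obtain ⟨hm, hl, hr⟩ := hE e he
      simp only [edges, Finset.mem_union, Finset.mem_insert, Finset.mem_singleton] at hm
      rcases hm with (rfl | rfl | rfl) | hm | hm | hm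
      · grind
      · grind
      · grind
      · have := endpoints_mem hm
        grind
      · have := endpoints_mem hm
        have : ∀ u ∈ t₂.left, u ∈ block x t₁ t₂ := by simp +contextual [block]
        have : ∀ u ∈ t₂.right, u ∈ block x t₁ t₂ := by simp +contextual [block]
        grind
      · exact Or.inr (Or.inr hm)
    by_cases hc : ∃ e ∈ Q, e ∉ t₃.edges x b c
    · obtain ⟨e, he, hne⟩ := hc
      refine hQ.card_le_of_cover [x] [c] fun e' he' => ?_
      have k := key e he
      have k' := key e' he'
      have q := hQ e he e' he'
      by_cases hm : e' ∈ t₃.edges x b c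
      · have := endpoints_mem hm
        simp
        grind
      · simp
        grind
    · push Not at hc
      exact h₃ o₃ fun e he => ⟨hc e he, (hE e he).2⟩
  | after x t₁ t₂ t₃ h₁ h₂ h₃ =>
    obtain ⟨⟨o₁, o₂, o₃⟩, o₄, o₅⟩ := h.after
    have m₁ := o₁.mem
    have m₂ := o₂.mem
    have m₃ := o₃.mem
    have key : ∀ e ∈ Q, (e.1 = a ∧ f x ≤ f e.2) ∨ (e.1 = a ∧ e.2 ∈ block x t₁ t₂) ∨
        e ∈ t₃.edges a b x := by
      intro e he
      obtain ⟨hm, hl, hr⟩ := hE e he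
      simp only [edges, Finset.mem_union, Finset.mem_insert, Finset.mem_singleton] at hm
      rcases hm with (rfl | rfl | rfl) | hm | hm | hm
      · grind
      · grind
      · grind
      · have := endpoints_mem hm
        grind
      · have := endpoints_mem hm
        have : ∀ u ∈ t₂.left, u ∈ block x t₁ t₂ := by simp +contextual [block]
        have : ∀ u ∈ t₂.right, u ∈ block x t₁ t₂ := by simp +contextual [block]
        grind
      · exact Or.inr (Or.inr hm)
    by_cases hc : ∃ e ∈ Q, e ∉ t₃.edges a b x
    · obtain ⟨e, he, hne⟩ := hc
      refine hQ.card_le_of_cover [a] [x] fun e' he' => ?_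
      have k := key e he
      have k' := key e' he'
      have q := hQ e he e' he'
      by_cases hm : e' ∈ t₃.edges a b x
      · have := endpoints_mem hm
        simp
        grind
      · simp
        grind
    · push Not at hc
      exact h₃ o₃ fun e he => ⟨hc e he, (hE e he).2⟩

/-- Every twist that is crossed by a vertical line to the left of the middle vertex `b` has size
at most five, where besides the edges of the subdivision arbitrary edges are allowed that enter
`b` from the left of all inner vertices. -/
def LeftBounded (t : FaceTree) : Prop :=
  ∀ (f : ℕ → ℤ) (a b c : ℕ), Ordered f t a b c → ∀ Q : Finset (ℕ × ℕ), TwistSet f Q →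
    (∀ e ∈ Q, e ∈ t.edges a b c ∨ (e.2 = b ∧ ∀ y ∈ t.left, f e.1 < f y)) →
    (∃ e ∈ Q, f e.2 < f b) → Q.card ≤ 5

theorem card_le_five_of_left {f : ℕ → ℤ} {x p₁ p₂ q₁ q₂ : ℕ} {t₁ t₂ : FaceTree}
    (h₁ : LeftBounded t₁) (h₂ : LeftBounded t₂)
    (o₁ : Ordered f t₁ p₁ x q₁) (o₂ : Ordered f t₂ p₂ x q₂) (hp : f p₂ ≤ f p₁)
    (hb : (block x t₁ t₂).Pairwise fun u v => f u < f v)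
    (hlo : ∀ u ∈ block x t₁ t₂, f p₁ < f u) (hhi : ∀ u ∈ block x t₁ t₂, f u < f q₁)
    {Q : Finset (ℕ × ℕ)} (hQ : TwistSet f Q)
    (hE : ∀ e ∈ Q, e ∈ t₁.edges p₁ x q₁ ∨ e ∈ t₂.edges p₂ x q₂ ∨
      (e.2 = x ∧ ∀ u ∈ block x t₁ t₂, f e.1 < f u) ∨
      (e.1 = x ∧ ∀ u ∈ block x t₁ t₂, f u < f e.2))
    (hl : ∃ e ∈ Q, f e.2 < f x) : Q.card ≤ 5 := by
  classical
  obtain ⟨e₀, he₀, hlt⟩ := hl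
  have m₁ := o₁.mem
  have m₂ := o₂.mem
  simp only [block, List.mem_append, List.mem_cons, List.pairwise_append,
    List.pairwise_cons] at hb hlo hhi hE
  have i₁ : ∀ u ∈ t₁.left, (∀ v ∈ t₂.left, f u < f v) ∧ (∀ v ∈ t₂.right, f u < f v) := by
    grind
  have i₂ : ∀ u ∈ t₁.right, (∀ v ∈ t₂.left, f v < f u) ∧ (∀ v ∈ t₂.right, f v < f u) := by
    grind
  have i₃ : ∀ v ∈ t₂.left, f p₁ < f v ∧ f v < f q₁ := by grind
  have i₄ : ∀ v ∈ t₂.right, f p₁ < f v ∧ f v < f q₁ := by grind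
  have hE' : ∀ e ∈ Q, e ∈ t₁.edges p₁ x q₁ ∨ e ∈ t₂.edges p₂ x q₂ ∨
      (e.2 = x ∧ (∀ u ∈ t₁.left, f e.1 < f u) ∧ (∀ u ∈ t₂.left, f e.1 < f u)) := by
    intro e he
    have := hE e he
    have := hQ e he e₀ he₀
    grind
  clear hE hb hlo hhi
  by_cases hA : ∃ e ∈ Q, e.2 ∈ t₁.left
  · obtain ⟨e₁, he₁, hm₁⟩ := hA
    have hs : f p₁ ≤ f e₁.1 := by
      have := hQ e₁ he₁ e₁ he₁
      rcases hE' e₁ he₁ with h | h | h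
      · have := endpoints_mem h
        grind
      · have := endpoints_mem h
        grind
      · grind
    refine h₁ f p₁ x q₁ o₁ Q hQ (fun e he => ?_) ⟨e₁, he₁, (m₁.2.2.1 _ hm₁).2⟩
    have q := hQ e he e₁ he₁
    rcases hE' e he with h | h | h
    · exact Or.inl h
    · have := endpoints_mem h
      grind
    · exact Or.inr ⟨h.1, h.2.1⟩
  · push Not at hA
    by_cases hB : ∃ e ∈ Q, e ∈ t₁.edges p₁ x q₁ ∧ e.2 ≠ x
    · obtain ⟨g, hg, hgm, hgx⟩ := hB
      have key : ∀ e ∈ Q, e ∈ t₁.edges p₁ x q₁ → e.2 ≠ x → f e.1 < f x ∧ f x < f e.2 := by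
        intro e he hm hne
        have := endpoints_mem hm
        have := hQ e he e₀ he₀
        have := hA e he
        grind
      have hgs : ∀ v ∈ t₂.left, f g.1 < f v ∧ f v < f g.2 := by
        have := endpoints_mem hgm
        have := key g hg hgm hgx
        grind
      have hgr : ∀ v ∈ t₂.right, f v < f g.2 := by
        have := endpoints_mem hgm
        have := key g hg hgm hgx
        grind
      have hgx := key g hg hgm hgx
      have c₁ : (Q.filter fun e => e ∈ t₁.edges p₁ x q₁ ∧ e.2 ≠ x).card ≤ 2 := by
        refine card_spanning_le_two o₁ (hQ.mono (Finset.filter_subset _ _)) fun e he => ?_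
        rw [Finset.mem_filter] at he
        exact ⟨he.2.1, key e he.1 he.2.1 he.2.2⟩
      have c₂ : (Q.filter fun e => ¬ (e ∈ t₁.edges p₁ x q₁ ∧ e.2 ≠ x)).card ≤ 3 := by
        refine (hQ.mono (Finset.filter_subset _ _)).card_le_of_cover [p₂] [q₂, x] fun e he => ?_
        rw [Finset.mem_filter] at he
        obtain ⟨he, hne⟩ := he
        have q₀ := hQ e he e₀ he₀
        have qg := hQ e he g hg
        simp only [List.mem_cons, List.not_mem_nil, or_false]
        rcases hE' e he with h | h | h
        · tauto
        · have := endpoints_mem h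
          grind
        · tauto
      have := Finset.card_filter_add_card_filter_not (s := Q)
        (fun e => e ∈ t₁.edges p₁ x q₁ ∧ e.2 ≠ x)
      omega
    · push Not at hB
      refine h₂ f p₂ x q₂ o₂ Q hQ (fun e he => ?_) ⟨e₀, he₀, hlt⟩
      rcases hE' e he with h | h | h
      · have := hB e he h
        have := endpoints_mem h
        have := hQ e he e he
        refine Or.inr ⟨‹_›, ?_⟩
        grind
      · exact Or.inl h
      · exact Or.inr ⟨h.1, h.2.2⟩

theorem block_mirror (x : ℕ) (t₁ t₂ : FaceTree) :
    block x t₁.mirror t₂.mirror = (block x t₁ t₂).reverse := by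
  simp [block, mirror_sides]

theorem block_card_le_five {f : ℕ → ℤ} {x p₁ p₂ q₁ q₂ : ℕ} {t₁ t₂ : FaceTree}
    (h₁ : LeftBounded t₁) (h₂ : LeftBounded t₂)
    (h₁' : LeftBounded t₁.mirror) (h₂' : LeftBounded t₂.mirror)
    (o₁ : Ordered f t₁ p₁ x q₁) (o₂ : Ordered f t₂ p₂ x q₂)
    (hp : f p₂ ≤ f p₁) (hq : f q₁ ≤ f q₂)
    (hb : (block x t₁ t₂).Pairwise fun u v => f u < f v)
    (hlo : ∀ u ∈ block x t₁ t₂, f p₁ < f u) (hhi : ∀ u ∈ block x t₁ t₂, f u < f q₁)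
    {Q : Finset (ℕ × ℕ)} (hQ : TwistSet f Q)
    (hE : ∀ e ∈ Q, e ∈ t₁.edges p₁ x q₁ ∨ e ∈ t₂.edges p₂ x q₂ ∨
      (e.2 = x ∧ ∀ u ∈ block x t₁ t₂, f e.1 < f u) ∨
      (e.1 = x ∧ ∀ u ∈ block x t₁ t₂, f u < f e.2)) : Q.card ≤ 5 := by
  classical
  by_cases hl : ∃ e ∈ Q, f e.2 < f x
  · exact card_le_five_of_left h₁ h₂ o₁ o₂ hp hb hlo hhi hQ hE hl
  by_cases hr : ∃ e ∈ Q, f x < f e.1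
  · rw [← Finset.card_image_of_injective Q Prod.swap_injective]
    refine card_le_five_of_left (f := fun v => -f v) h₁' h₂' o₁.mirror o₂.mirror
      (by simpa using hq) ?_ ?_ ?_ hQ.swap ?_ ?_
    · rw [block_mirror, List.pairwise_reverse]
      simpa using hb
    · simpa [block_mirror] using hhi
    · simpa [block_mirror] using hlo
    · intro e he
      obtain ⟨d, hd, rfl⟩ := Finset.mem_image.1 he
      have := hE d hd
      simp only [mem_edges_mirror, Prod.swap_swap, Prod.fst_swap, Prod.snd_swap, neg_lt_neg_iff,
        block_mirror, List.mem_reverse]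
      tauto
    · obtain ⟨e, he, hlt⟩ := hr
      exact ⟨e.swap, Finset.mem_image_of_mem _ he, by simpa using hlt⟩
  · push Not at hl hr
    have m₁ := o₁.mem
    have m₂ := o₂.mem
    have c₁ : (Q.filter fun e => e ∈ t₁.edges p₁ x q₁ ∧ e.1 ≠ x ∧ e.2 ≠ x).card ≤ 2 := by
      refine card_spanning_le_two o₁ (hQ.mono (Finset.filter_subset _ _)) fun e he => ?_
      rw [Finset.mem_filter] at he
      have := endpoints_mem he.2.1
      have := hl e he.1
      have := hr e he.1
      grind
    have c₂ : (Q.filter fun e => e ∈ t₂.edges p₂ x q₂ ∧ e.1 ≠ x ∧ e.2 ≠ x).card ≤ 2 := by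
      refine card_spanning_le_two o₂ (hQ.mono (Finset.filter_subset _ _)) fun e he => ?_
      rw [Finset.mem_filter] at he
      have := endpoints_mem he.2.1
      have := hl e he.1
      have := hr e he.1
      grind
    have c₃ : (Q.filter fun e => e.1 = x ∨ e.2 = x).card ≤ 1 :=
      (hQ.mono (Finset.filter_subset _ _)).card_incident_le_one x fun e he =>
        (Finset.mem_filter.1 he).2
    have hsub : Q ⊆ (Q.filter fun e => e ∈ t₁.edges p₁ x q₁ ∧ e.1 ≠ x ∧ e.2 ≠ x) ∪
        (Q.filter fun e => e ∈ t₂.edges p₂ x q₂ ∧ e.1 ≠ x ∧ e.2 ≠ x) ∪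
        (Q.filter fun e => e.1 = x ∨ e.2 = x) := by
      intro e he
      have := hE e he
      simp only [Finset.mem_union, Finset.mem_filter]
      tauto
    have := Finset.card_le_card hsub
    have := Finset.card_union_le ((Q.filter fun e => e ∈ t₁.edges p₁ x q₁ ∧ e.1 ≠ x ∧ e.2 ≠ x) ∪
        (Q.filter fun e => e ∈ t₂.edges p₂ x q₂ ∧ e.1 ≠ x ∧ e.2 ≠ x))
        (Q.filter fun e => e.1 = x ∨ e.2 = x)
    have := Finset.card_union_le (Q.filter fun e => e ∈ t₁.edges p₁ x q₁ ∧ e.1 ≠ x ∧ e.2 ≠ x)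
        (Q.filter fun e => e ∈ t₂.edges p₂ x q₂ ∧ e.1 ≠ x ∧ e.2 ≠ x)
    omega

set_option maxHeartbeats 1000000 in
theorem leftBounded_before {x : ℕ} {t₁ t₂ t₃ : FaceTree}
    (h₁ : LeftBounded t₁) (h₂ : LeftBounded t₂) (h₁' : LeftBounded t₁.mirror)
    (h₂' : LeftBounded t₂.mirror) (h₃ : LeftBounded t₃) : LeftBounded (before x t₁ t₂ t₃) := by
  rintro f a b c o Q hQ hE ⟨e₀, he₀, hlt⟩
  obtain ⟨⟨o₁, o₂, o₃⟩, hb, hN⟩ := o.before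
  have m₁ := o₁.mem
  have m₂ := o₂.mem
  have m₃ := o₃.mem
  have hx : x ∈ block x t₁ t₂ := by simp [block]
  have s₁ : (∀ u ∈ t₁.left, u ∈ block x t₁ t₂) ∧ (∀ u ∈ t₁.right, u ∈ block x t₁ t₂) := by
    simp +contextual [block]
  have s₂ : (∀ u ∈ t₂.left, u ∈ block x t₁ t₂) ∧ (∀ u ∈ t₂.right, u ∈ block x t₁ t₂) := by
    simp +contextual [block]
  have loc₁ : ∀ e ∈ t₁.edges a x b, (e.1 = a ∨ e.1 ∈ block x t₁ t₂) ∧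
      (e.2 ∈ block x t₁ t₂ ∨ e.2 = b) := fun e he => by
    have := endpoints_mem he
    grind
  have loc₂ : ∀ e ∈ t₂.edges a x c, (e.1 = a ∨ e.1 ∈ block x t₁ t₂) ∧
      (e.2 ∈ block x t₁ t₂ ∨ e.2 = c) := fun e he => by
    have := endpoints_mem he
    grind
  have loc₃ := fun (e : ℕ × ℕ) (he : e ∈ t₃.edges x b c) => endpoints_mem he
  simp only [edges, left_before, Finset.mem_union, Finset.mem_insert, Finset.mem_singleton,
    List.mem_append, Prod.ext_iff] at hE
  clear s₁ s₂
  by_cases hA : ∃ e ∈ Q, e.2 ∈ block x t₁ t₂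
  · obtain ⟨e₁, he₁, hm₁⟩ := hA
    have hs₃ : ∀ e ∈ Q, e ∈ t₃.edges x b c → e.1 = x ∧ ∀ u ∈ block x t₁ t₂, f u < f e.2 := by
      intro e he h
      have := loc₃ e h
      have := hQ e he e₁ he₁
      grind
    by_cases hO : ∃ e ∈ Q, e.2 = b ∧ ∀ u ∈ block x t₁ t₂, f e.1 < f u
    · obtain ⟨g, hg, hgb, hgl⟩ := hO
      refine (hQ.card_le_of_cover [a, x] [b, c] fun e he => ?_).trans (by simp)
      simp only [List.mem_cons, List.not_mem_nil, or_false]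
      have qg := hQ e he g hg
      rcases hE e he with ((h | h | h) | h | h | h) | h
      · tauto
      · tauto
      · tauto
      · have := loc₁ e h
        grind
      · have := loc₂ e h
        grind
      · exact Or.inl (Or.inr (hs₃ e he h).1)
      · tauto
    · push Not at hO
      refine block_card_le_five h₁ h₂ h₁' h₂' o₁ o₂ le_rfl m₃.2.1.le hb (fun u hu => (hN u hu).1)
        (fun u hu => (hN u hu).2.1) hQ fun e he => ?_
      rcases hE e he with ((h | h | h) | h | h | h) | h
      · right; right; left
        grind
      · right; right; right
        grind
      · right; right; right
        grind
      · exact Or.inl h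
      · exact Or.inr (Or.inl h)
      · exact Or.inr (Or.inr (Or.inr (hs₃ e he h)))
      · obtain ⟨u, hu, hlt⟩ := hO e he h.1
        exact absurd (h.2 u (Or.inl hu)) hlt.not_gt
  · push Not at hA
    by_cases hC : ∃ e ∈ Q, e.2 = c ∧ (e.1 = a ∨ e.1 ∈ block x t₁ t₂)
    · obtain ⟨g, hg, hgc, hgl⟩ := hC
      refine (hQ.card_le_of_cover [x] [b, c] fun e he => ?_).trans (by simp)
      simp only [List.mem_cons, List.not_mem_nil, or_false]
      have qg := hQ e he g hg
      have hAe := hA e he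
      rcases hE e he with ((h | h | h) | h | h | h) | h
      · grind
      · tauto
      · tauto
      · have := loc₁ e h
        tauto
      · have := loc₂ e h
        tauto
      · have := loc₃ e h
        grind
      · tauto
    · push Not at hC
      refine h₃ f x b c o₃ Q hQ (fun e he => ?_) ⟨e₀, he₀, hlt⟩
      have hAe := hA e he
      have hCe := hC e he
      rcases hE e he with ((h | h | h) | h | h | h) | h
      · grind
      · right
        grind
      · grind
      · right
        have := loc₁ e h
        grind
      · have := loc₂ e h
        grind
      · exact Or.inl h
      · exact Or.inr ⟨h.1, fun y hy => h.2 y (Or.inr hy)⟩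

theorem leftBounded_after {x : ℕ} {t₁ t₂ t₃ : FaceTree} (h₃ : LeftBounded t₃) :
    LeftBounded (after x t₁ t₂ t₃) := by
  rintro f a b c o Q hQ hE ⟨e₀, he₀, hlt⟩
  obtain ⟨⟨o₁, o₂, o₃⟩, hb, hN⟩ := o.after
  have m₁ := o₁.mem
  have m₂ := o₂.mem
  have m₃ := o₃.mem
  have hx : x ∈ block x t₁ t₂ := by simp [block]
  have s₂ : (∀ u ∈ t₂.left, u ∈ block x t₁ t₂) ∧ (∀ u ∈ t₂.right, u ∈ block x t₁ t₂) := by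
    simp +contextual [block]
  simp only [edges, left_after, Finset.mem_union, Finset.mem_insert, Finset.mem_singleton,
    Prod.ext_iff] at hE
  have key : ∀ e ∈ Q, (e.1 = a ∧ f b < f e.2) ∨ e ∈ t₃.edges a b x ∨
      (e.2 = b ∧ ∀ y ∈ t₃.left, f e.1 < f y) := by
    intro e he
    have q := hQ e he e₀ he₀
    rcases hE e he with ((h | h | h) | h | h | h) | h
    · grind
    · grind
    · grind
    · have := endpoints_mem h
      grind
    · have := endpoints_mem h
      grind
    · exact Or.inr (Or.inl h)
    · exact Or.inr (Or.inr h)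
  refine h₃ f a b x o₃ Q hQ (fun e he => ?_) ⟨e₀, he₀, hlt⟩
  refine (key e he).resolve_left fun h => ?_
  have q := hQ e he e₀ he₀
  rcases key e₀ he₀ with k | k | k
  · grind
  · have := endpoints_mem k
    have := hQ e₀ he₀ e₀ he₀
    grind
  · grind

theorem leftBounded_and_mirror (t : FaceTree) : LeftBounded t ∧ LeftBounded t.mirror := by
  induction t with
  | leaf =>
    have h : LeftBounded leaf := by
      rintro f a b c - Q hQ hE -
      refine (hQ.card_le_of_cover [] [b] fun e he => ?_).trans (by simp)
      simpa [edges] using hE e he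
    exact ⟨h, h⟩
  | before x t₁ t₂ t₃ h₁ h₂ h₃ =>
    exact ⟨leftBounded_before h₁.1 h₂.1 h₁.2 h₂.2 h₃.1, leftBounded_after h₃.2⟩
  | after x t₁ t₂ t₃ h₁ h₂ h₃ =>
    refine ⟨leftBounded_after h₃.1, leftBounded_before h₁.2 h₂.2 ?_ ?_ h₃.2⟩
    · rw [mirror_mirror]; exact h₁.1
    · rw [mirror_mirror]; exact h₂.1

theorem card_le_five {f : ℕ → ℤ} {t : FaceTree} {a b c : ℕ} (o : Ordered f t a b c)
    {Q : Finset (ℕ × ℕ)} (hQ : TwistSet f Q)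
    (hE : ∀ e ∈ Q, e ∈ ({(a, b), (b, c), (a, c)} : Finset (ℕ × ℕ)) ∨ e ∈ t.edges a b c) :
    Q.card ≤ 5 := by
  classical
  have m := o.mem
  simp only [Finset.mem_insert, Finset.mem_singleton, Prod.ext_iff] at hE
  by_cases hac : (a, c) ∈ Q
  · refine (Finset.card_le_one.2 fun e he e' he' => ?_).trans (by norm_num)
    have key : ∀ e ∈ Q, e = (a, c) := by
      intro e he
      have := hQ e he _ hac
      rcases hE e he with (h | h | h) | h
      · grind
      · grind
      · grind
      · have := endpoints_mem h
        grind
    rw [key e he, key e' he']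
  have hE' : ∀ e ∈ Q, (e.1 = a ∧ e.2 = b) ∨ (e.1 = b ∧ e.2 = c) ∨ e ∈ t.edges a b c := by
    intro e he
    rcases hE e he with (h | h | h) | h
    · exact Or.inl h
    · exact Or.inr (Or.inl h)
    · exact absurd ((Prod.ext h.1 h.2 : e = (a, c)) ▸ he) hac
    · exact Or.inr (Or.inr h)
  by_cases hl : ∃ e ∈ Q, f e.2 < f b
  · refine (leftBounded_and_mirror t).1 f a b c o Q hQ (fun e he => ?_) hl
    obtain ⟨e₀, he₀, hlt⟩ := hl
    have := hQ e he e₀ he₀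
    rcases hE' e he with h | h | h
    · exact Or.inr ⟨h.2, fun y hy => h.1 ▸ (m.2.2.1 y hy).1⟩
    · grind
    · exact Or.inl h
  by_cases hr : ∃ e ∈ Q, f b < f e.1
  · rw [← Finset.card_image_of_injective Q Prod.swap_injective]
    obtain ⟨e₀, he₀, hlt⟩ := hr
    refine (leftBounded_and_mirror t).2 _ c b a o.mirror _ hQ.swap (fun e he => ?_)
      ⟨e₀.swap, Finset.mem_image_of_mem _ he₀, by simpa using hlt⟩
    obtain ⟨d, hd, rfl⟩ := Finset.mem_image.1 he
    have := hQ e₀ he₀ d hd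
    simp only [mem_edges_mirror, Prod.swap_swap, Prod.fst_swap, Prod.snd_swap, neg_lt_neg_iff,
      mirror_sides, List.mem_reverse]
    rcases hE' d hd with h | h | h
    · grind
    · exact Or.inr ⟨h.1, fun y hy => h.2 ▸ (m.2.2.2 y hy).2⟩
    · exact Or.inl h
  · push Not at hl hr
    have c₁ : (Q.filter fun e => e.1 ≠ b ∧ e.2 ≠ b).card ≤ 2 := by
      refine card_spanning_le_two o (hQ.mono (Finset.filter_subset _ _)) fun e he => ?_
      rw [Finset.mem_filter] at he
      have := hl e he.1
      have := hr e he.1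
      have h := ((hE' e he.1).resolve_left fun h => he.2.2 h.2).resolve_left fun h => he.2.1 h.1
      have := endpoints_mem h
      grind
    have c₂ : (Q.filter fun e => ¬ (e.1 ≠ b ∧ e.2 ≠ b)).card ≤ 1 := by
      refine (hQ.mono (Finset.filter_subset _ _)).card_incident_le_one b fun e he => ?_
      rw [Finset.mem_filter] at he
      tauto
    have := Finset.card_filter_add_card_filter_not (s := Q) (fun e => e.1 ≠ b ∧ e.2 ≠ b)
    omega

/-- A subdivision `s` of a face of the subdivision `t` can be glued into `t`. -/
theorem exists_refinement (s : FaceTree) {t : FaceTree} {a b c p q r : ℕ}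
    (h : (p, q, r) ∈ t.faces a b c) :
    ∃ t' : FaceTree, t'.edges a b c = t.edges a b c ∪ s.edges p q r ∧
      (∀ v, t'.left.count v + t'.right.count v =
        t.left.count v + t.right.count v + (s.left.count v + s.right.count v)) ∧
      (t.faces a b c).erase (p, q, r) ∪ s.faces p q r ⊆ t'.faces a b c := by
  induction t generalizing a b c with
  | leaf =>
    simp only [faces, Finset.mem_singleton, Prod.mk.injEq] at h
    obtain ⟨rfl, rfl, rfl⟩ := h
    exact ⟨s, by simp [edges], by simp, by simp [faces]⟩
  | before x t₁ t₂ t₃ h₁ h₂ h₃ =>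
    simp only [faces, Finset.mem_union] at h
    rcases h with h | h | h
    · obtain ⟨t', he, hc, hf⟩ := h₁ h
      refine ⟨before x t' t₂ t₃, ?_, fun v => ?_, ?_⟩
      · ext; simp only [edges, he, Finset.mem_union]; tauto
      · have := hc v
        simp only [left_before, right_before, block, List.count_append, List.count_cons]
        omega
      · intro φ hφ
        have := @hf φ
        simp only [faces, Finset.mem_union, Finset.mem_erase] at *
        tauto
    · obtain ⟨t', he, hc, hf⟩ := h₂ h
      refine ⟨before x t₁ t' t₃, ?_, fun v => ?_, ?_⟩
      · ext; simp only [edges, he, Finset.mem_union]; tauto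
      · have := hc v
        simp only [left_before, right_before, block, List.count_append, List.count_cons]
        omega
      · intro φ hφ
        have := @hf φ
        simp only [faces, Finset.mem_union, Finset.mem_erase] at *
        tauto
    · obtain ⟨t', he, hc, hf⟩ := h₃ h
      refine ⟨before x t₁ t₂ t', ?_, fun v => ?_, ?_⟩
      · ext; simp only [edges, he, Finset.mem_union]; tauto
      · have := hc v
        simp only [left_before, right_before, block, List.count_append, List.count_cons]
        omega
      · intro φ hφ
        have := @hf φ
        simp only [faces, Finset.mem_union, Finset.mem_erase] at *
        tauto
  | after x t₁ t₂ t₃ h₁ h₂ h₃ =>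
    simp only [faces, Finset.mem_union] at h
    rcases h with h | h | h
    · obtain ⟨t', he, hc, hf⟩ := h₁ h
      refine ⟨after x t' t₂ t₃, ?_, fun v => ?_, ?_⟩
      · ext; simp only [edges, he, Finset.mem_union]; tauto
      · have := hc v
        simp only [left_after, right_after, block, List.count_append, List.count_cons]
        omega
      · intro φ hφ
        have := @hf φ
        simp only [faces, Finset.mem_union, Finset.mem_erase] at *
        tauto
    · obtain ⟨t', he, hc, hf⟩ := h₂ h
      refine ⟨after x t₁ t' t₃, ?_, fun v => ?_, ?_⟩
      · ext; simp only [edges, he, Finset.mem_union]; tauto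
      · have := hc v
        simp only [left_after, right_after, block, List.count_append, List.count_cons]
        omega
      · intro φ hφ
        have := @hf φ
        simp only [faces, Finset.mem_union, Finset.mem_erase] at *
        tauto
    · obtain ⟨t', he, hc, hf⟩ := h₃ h
      refine ⟨after x t₁ t₂ t', ?_, fun v => ?_, ?_⟩
      · ext; simp only [edges, he, Finset.mem_union]; tauto
      · have := hc v
        simp only [left_after, right_after, block, List.count_append, List.count_cons]
        omega
      · intro φ hφ
        have := @hf φ
        simp only [faces, Finset.mem_union, Finset.mem_erase] at *
        tauto

/-- `t` describes how the graph `E` with faces `F` arises from the triangle `(a, b, c)`. -/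
structure Represents (t : FaceTree) (a b c : ℕ) (E : Finset (ℕ × ℕ)) (F : Finset (ℕ × ℕ × ℕ)) :
    Prop where
  edges_eq : E = {(a, b), (b, c), (a, c)} ∪ t.edges a b c
  faces_subset : F ⊆ t.faces a b c
  count_le_one : ∀ v, (a :: (t.left ++ b :: (t.right ++ [c]))).count v ≤ 1
  mem_verts : ∀ v ∈ a :: (t.left ++ b :: (t.right ++ [c])), v ∈ verts E

/-- Refining a face by a subdivision with a single, fresh, inner vertex. -/
theorem Represents.refine {t s : FaceTree} {a b c p q r x : ℕ} {E E' : Finset (ℕ × ℕ)}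
    {F F' : Finset (ℕ × ℕ × ℕ)} (h : Represents t a b c E F) (hF : (p, q, r) ∈ F)
    (hx : x ∉ verts E) (hs : ∀ v, s.left.count v + s.right.count v = [x].count v)
    (hxs : x ∈ verts (s.edges p q r)) (hE' : E' = E ∪ s.edges p q r)
    (hF' : F' = F.erase (p, q, r) ∪ s.faces p q r) : ∃ t', Represents t' a b c E' F' := by
  obtain ⟨t', he, hc, hf⟩ := exists_refinement s (h.faces_subset hF)
  have key : ∀ v, (a :: (t'.left ++ b :: (t'.right ++ [c]))).count v =
      (a :: (t.left ++ b :: (t.right ++ [c]))).count v + [x].count v := by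
    intro v
    have := hc v
    have := hs v
    simp only [List.count_append, List.count_cons] at *
    omega
  refine ⟨t', ?_, ?_, fun v => ?_, fun v hv => ?_⟩
  · rw [hE', he, h.edges_eq, Finset.union_assoc]
  · rw [hF']
    exact (Finset.union_subset_union (Finset.erase_subset_erase _ h.faces_subset) le_rfl).trans hf
  · rw [key]
    by_cases hv : v = x
    · subst hv
      rw [List.count_eq_zero.2 fun hm => hx (h.mem_verts v hm)]
      simp
    · rw [(List.count_eq_zero (a := v) (l := [x])).2 (by simpa using hv)]
      exact h.count_le_one v
  · have hsub : verts E ⊆ verts E' ∧ verts (s.edges p q r) ⊆ verts E' := by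
      simp only [hE', verts, Finset.image_union]
      constructor <;> intro y <;> simp only [Finset.mem_union] <;> tauto
    rw [← List.count_pos_iff, key] at hv
    by_cases hvx : v = x
    · exact hvx ▸ hsub.2 hxs
    · rw [(List.count_eq_zero (a := v) (l := [x])).2 (by simpa using hvx), add_zero,
        List.count_pos_iff] at hv
      exact hsub.1 (h.mem_verts v hv)

theorem exists_represents {E : Finset (ℕ × ℕ)} {F : Finset (ℕ × ℕ × ℕ)} (h : UP3TBuild E F) :
    ∃ a b c t, Represents t a b c E F := by
  induction h with
  | base s m t h1 h2 h3 =>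
    refine ⟨s, m, t, leaf, by simp [edges], by simp [faces], ?_, ?_⟩
    · rw [← List.nodup_iff_count_le_one]
      simp [h1, h2, h3]
    · simp [verts]
  | insertBefore E F a b c x hE hF hx ih =>
    obtain ⟨p, q, r, t, h⟩ := ih
    refine ⟨p, q, r, h.refine (s := before x leaf leaf leaf) hF hx ?_ ?_ ?_ ?_⟩
    · simp [block]
    · simp [verts, edges]
    · ext; simp only [edges, Finset.mem_union, Finset.mem_insert, Finset.mem_singleton,
        Finset.notMem_empty]; tauto
    · ext; simp only [faces, Finset.mem_union, Finset.mem_insert, Finset.mem_singleton]; tauto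
  | insertAfter E F a b c x hE hF hx ih =>
    obtain ⟨p, q, r, t, h⟩ := ih
    refine ⟨p, q, r, h.refine (s := after x leaf leaf leaf) hF hx ?_ ?_ ?_ ?_⟩
    · simp [block]
    · simp [verts, edges]
    · ext; simp only [edges, Finset.mem_union, Finset.mem_insert, Finset.mem_singleton,
        Finset.notMem_empty]; tauto
    · ext; simp only [faces, Finset.mem_union, Finset.mem_insert, Finset.mem_singleton]; tauto

end FaceTree

/-- Every list without repetitions is increasing for some injective position function. -/
theorem List.Nodup.exists_injective_pairwise_lt {l : List ℕ} (h : l.Nodup) :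
    ∃ f : ℕ → ℕ, Function.Injective f ∧ l.Pairwise fun u v => f u < f v := by
  refine ⟨fun v => if v ∈ l then l.idxOf v else l.length + v, fun u v huv => ?_, ?_⟩
  · have hu := @List.idxOf_lt_length_iff _ _ _ l u
    have hv := @List.idxOf_lt_length_iff _ _ _ l v
    dsimp only at huv
    split_ifs at huv with h1 h2 h2
    · exact (List.idxOf_inj h1).1 huv
    · have := hu.2 h1; omega
    · have := hv.2 h2; omega
    · omega
  · rw [List.pairwise_iff_getElem]
    intro i j hi hj hij
    simpa [List.getElem_mem, h.idxOf_getElem] using hij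

/-- Every upward planar 3-tree admits a linear extension whose maximum twist
size is at most 5. -/
theorem upward_planar_three_tree_twist_le_five (E : Finset (ℕ × ℕ))
    (hE : IsUpwardPlanar3Tree E) :
    ∃ f, LinExt E f ∧ TwistLE E f 5 := by
  obtain ⟨F, hF⟩ := hE
  obtain ⟨a, b, c, t, ht⟩ := FaceTree.exists_represents hF
  obtain ⟨f, hf, hl⟩ :=
    (List.nodup_iff_count_le_one.2 ht.count_le_one).exists_injective_pairwise_lt
  have o : FaceTree.Ordered (fun v => (f v : ℤ)) t a b c := by
    simpa only [FaceTree.Ordered, Nat.cast_lt] using hl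
  have m := o.mem
  have mem : ∀ e ∈ E, e ∈ ({(a, b), (b, c), (a, c)} : Finset (ℕ × ℕ)) ∨ e ∈ t.edges a b c :=
    fun e he => by rwa [ht.edges_eq, Finset.mem_union] at he
  refine ⟨f, ⟨hf, fun e he => ?_⟩, fun k s d ⟨hsd, hs, hd, hlt⟩ => ?_⟩
  · rcases mem e he with h | h
    · simp only [Finset.mem_insert, Finset.mem_singleton] at h
      rcases h with rfl | rfl | rfl <;> dsimp only <;> omega
    · exact_mod_cast o.lt_of_mem_edges h
  · have hinj : Function.Injective fun i => (s i, d i) := fun i j hij =>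
      hs.injective (congrArg (fun e : ℕ × ℕ => f e.1) hij)
    have hc := FaceTree.card_le_five o (Q := Finset.univ.image fun i => (s i, d i)) ?_ ?_
    · rwa [Finset.card_image_of_injective _ hinj, Finset.card_fin] at hc
    · intro e he e' he'
      obtain ⟨i, -, rfl⟩ := Finset.mem_image.1 he
      obtain ⟨j, -, rfl⟩ := Finset.mem_image.1 he'
      refine ⟨Nat.cast_lt.2 (hlt i j), ?_⟩
      rcases lt_trichotomy i j with h | rfl | h
      · exact Or.inr (Or.inl ⟨Nat.cast_lt.2 (hs h), Nat.cast_lt.2 (hd h)⟩)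
      · exact Or.inl rfl
      · exact Or.inr (Or.inr ⟨Nat.cast_lt.2 (hs h), Nat.cast_lt.2 (hd h)⟩)
    · intro e he
      obtain ⟨i, -, rfl⟩ := Finset.mem_image.1 he
      exact mem _ (hsd i)
end

section
/- Any graph that admits a vertex order with no (k+1)-twist admits a stack layout with at most 7k^2 stacks under that same vertex order. -/
/-- Two positions are adjacent if they are the ends of an edge of `F`. -/
def PosAdj (F : Finset (ℕ × ℕ)) (x y : ℕ) : Prop := (x, y) ∈ F ∨ (y, x) ∈ F

/-- Every set of pairwise crossing edges of `F` has at most `k` elements. -/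
def CliqueLE (F : Finset (ℕ × ℕ)) (k : ℕ) : Prop :=
  ∀ A ⊆ F, (∀ e ∈ A, ∀ e' ∈ A, e ≠ e' → Crosses id e e') → A.card ≤ k

/-- The position `x` outside of the block `[A, B)` is adjacent to a position of `[a, b)`. -/
def Sees (F : Finset (ℕ × ℕ)) (A B a b x : ℕ) : Prop :=
  (x < A ∨ B ≤ x) ∧ ∃ y, a ≤ y ∧ y < b ∧ PosAdj F x y

/-- The colours under `ρ` of the positions outside of `[A, B)` adjacent to `[a, b)`. -/
noncomputable def seenColours (F : Finset (ℕ × ℕ)) (ρ : ℕ → ℕ) (A B a b : ℕ) : Finset ℕ :=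
  open Classical in ((verts F).filter (Sees F A B a b)).image ρ

/-- The cyclic order of the positions outside of a block starting at `a`:
first those to the right of the block, then those to the left. -/
def CycBefore (a x y : ℕ) : Prop := (a ≤ x ∧ y < a) ∨ (x < y ∧ (x < a ↔ y < a))

/-- The colour classes of `ρ` among the positions adjacent to `[a, b)` are
separated from each other in the cyclic order. -/
def Separated (F : Finset (ℕ × ℕ)) (ρ : ℕ → ℕ) (a b : ℕ) : Prop :=
  ∀ x y x' y', Sees F a b a b x → Sees F a b a b y → Sees F a b a b x' → Sees F a b a b y' →
    ρ x = ρ y → ρ x' = ρ y' → ρ x ≠ ρ x' → CycBefore a x x' → CycBefore a y y'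

/-- The edges inside `[a, b)` have a proper colouring by pairs which, in the first coordinate,
avoids the colour `ρ x` of each edge that crosses it and leaves the block towards `x`. -/
def BlockColourable (F : Finset (ℕ × ℕ)) (C k : ℕ) (ρ : ℕ → ℕ) (a b : ℕ) : Prop :=
  ∃ c : ℕ × ℕ → ℕ × ℕ,
    (∀ e ∈ F, a ≤ e.1 → e.2 < b → (c e).1 < C ∧ (c e).2 < k) ∧
    (∀ e ∈ F, ∀ e' ∈ F, a ≤ e.1 → e'.2 < b → e.1 < e'.1 → e'.1 < e.2 → e.2 < e'.2 →
      c e ≠ c e') ∧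
    (∀ e ∈ F, a ≤ e.1 → e.2 < b → ∀ x y, (x < a ∨ b ≤ x) → PosAdj F x y →
      e.1 < y → y < e.2 → (c e).1 ≠ ρ x)

/-- The block `[a, b)` is a concatenation of `n` blocks satisfying `G`. -/
def Concat (G : ℕ → ℕ → Prop) : ℕ → ℕ → ℕ → Prop
  | 0, a, b => a = b
  | n + 1, a, b => ∃ g, a ≤ g ∧ g ≤ b ∧ G a g ∧ Concat G n g b

/-- The colour function `ρ` with the block `[a, b)` recoloured by `γ`. -/
def recolour (ρ : ℕ → ℕ) (a b γ : ℕ) (x : ℕ) : ℕ := if a ≤ x ∧ x < b then γ else ρ x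

theorem mem_seenColours {F : Finset (ℕ × ℕ)} {ρ : ℕ → ℕ} {A B a b γ : ℕ} :
    γ ∈ seenColours F ρ A B a b ↔ ∃ x, Sees F A B a b x ∧ ρ x = γ := by
  classical
  simp only [seenColours, Finset.mem_image, Finset.mem_filter]
  constructor
  · rintro ⟨x, ⟨-, hx⟩, rfl⟩
    exact ⟨x, hx, rfl⟩
  · rintro ⟨x, hx, rfl⟩
    refine ⟨x, ⟨?_, hx⟩, rfl⟩
    obtain ⟨-, y, -, -, h | h⟩ := hx
    · exact Finset.mem_union_left _ (Finset.mem_image.2 ⟨_, h, rfl⟩)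
    · exact Finset.mem_union_right _ (Finset.mem_image.2 ⟨_, h, rfl⟩)

theorem seenColours_mono {F : Finset (ℕ × ℕ)} {ρ : ℕ → ℕ} {A B a b a' b' : ℕ}
    (ha : a ≤ a') (hb : b' ≤ b) : seenColours F ρ A B a' b' ⊆ seenColours F ρ A B a b := by
  intro γ
  simp only [mem_seenColours]
  rintro ⟨x, ⟨h, y, h1, h2, h3⟩, rfl⟩
  exact ⟨x, ⟨h, y, by omega, by omega, h3⟩, rfl⟩

/-- The edges over a fixed gap are properly coloured by the size of a largest twist
ending in them. -/
theorem exists_gap_colouring {F : Finset (ℕ × ℕ)} {k : ℕ} (hk : CliqueLE F k) (g : ℕ) :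
    ∃ h : ℕ × ℕ → ℕ, (∀ e ∈ F, e.1 < g → g ≤ e.2 → h e < k) ∧
      ∀ e ∈ F, ∀ e' ∈ F, e'.1 < g → g ≤ e.2 → e.1 < e'.1 → e.2 < e'.2 → h e < h e' := by
  classical
  let K : ℕ × ℕ → Finset (Finset (ℕ × ℕ)) := fun e => F.powerset.filter fun A =>
    (∀ u ∈ A, ∀ v ∈ A, u ≠ v → Crosses id u v) ∧
      ∀ u ∈ A, u.1 < g ∧ g ≤ u.2 ∧ u.1 < e.1 ∧ u.2 < e.2
  have key : ∀ e ∈ F, e.1 < g → g ≤ e.2 → ∀ A ∈ K e,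
      e ∉ A ∧ insert e A ⊆ F ∧ ∀ u ∈ insert e A, ∀ v ∈ insert e A, u ≠ v → Crosses id u v := by
    intro e he h1 h2 A hA
    obtain ⟨hAF, hA1, hA2⟩ := Finset.mem_filter.1 hA
    rw [Finset.mem_powerset] at hAF
    refine ⟨fun h => absurd (hA2 _ h).2.2.1 (lt_irrefl _), Finset.insert_subset he hAF, ?_⟩
    intro u hu v hv huv
    rw [Finset.mem_insert] at hu hv
    rcases hu with rfl | hu <;> rcases hv with rfl | hv
    · exact absurd rfl huv
    · have := hA2 _ hv
      exact Or.inr ⟨by simp; omega, by simp; omega, by simp; omega⟩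
    · have := hA2 _ hu
      exact Or.inl ⟨by simp; omega, by simp; omega, by simp; omega⟩
    · exact hA1 u hu v hv huv
  refine ⟨fun e => (K e).sup Finset.card, ?_, ?_⟩
  · intro e he h1 h2
    have hpos : 0 < k := by
      have := hk {e} (by simpa using he) (by simp +contextual)
      simp at this; omega
    rw [Finset.sup_lt_iff hpos]
    intro A hA
    obtain ⟨h3, h4, h5⟩ := key e he h1 h2 A hA
    have := hk _ h4 h5
    rw [Finset.card_insert_of_notMem h3] at this
    omega
  · intro e he e' he' h1 h2 h3 h4
    have hne : (K e).Nonempty := ⟨∅, by simp [K]⟩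
    obtain ⟨A, hA, hAe⟩ := Finset.exists_mem_eq_sup (K e) hne Finset.card
    obtain ⟨h5, h6, h7⟩ := key e he (by omega) h2 A hA
    have hmem : insert e A ∈ K e' := by
      refine Finset.mem_filter.2 ⟨Finset.mem_powerset.2 h6, h7, ?_⟩
      intro u hu
      rw [Finset.mem_insert] at hu
      rcases hu with rfl | hu
      · omega
      · have := (Finset.mem_filter.1 hA).2.2 u hu
        omega
    have := Finset.le_sup (f := Finset.card) hmem
    rw [Finset.card_insert_of_notMem h5] at this
    change (K e).sup Finset.card < (K e').sup Finset.card
    omega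

theorem BlockColourable.split {F : Finset (ℕ × ℕ)} {C k : ℕ}
    (hk : CliqueLE F k) {ρ : ℕ → ℕ} {a g b γ : ℕ} (hγ : γ < C)
    (hun : ∀ x, Sees F a b a b x → ρ x ≠ γ) (hag : a ≤ g) (hgb : g ≤ b)
    (h₁ : BlockColourable F C k (recolour ρ a b γ) a g)
    (h₂ : BlockColourable F C k (recolour ρ a b γ) g b) : BlockColourable F C k ρ a b := by
  obtain ⟨c₁, hb₁, hp₁, ho₁⟩ := h₁
  obtain ⟨c₂, hb₂, hp₂, ho₂⟩ := h₂
  obtain ⟨h, hh, hlt⟩ := exists_gap_colouring hk g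
  have hin : ∀ x, a ≤ x → x < b → recolour ρ a b γ x = γ := fun x h1 h2 => if_pos ⟨h1, h2⟩
  have hout : ∀ x, (x < a ∨ b ≤ x) → recolour ρ a b γ x = ρ x := fun x h1 =>
    if_neg (by omega)
  have hor : ∀ e : ℕ × ℕ, e.2 < g ∨ (g ≤ e.2 ∧ g ≤ e.1) ∨ (g ≤ e.2 ∧ e.1 < g) := by
    intro e; omega
  let c : ℕ × ℕ → ℕ × ℕ := fun e =>
    if e.2 < g then c₁ e else if g ≤ e.1 then c₂ e else (γ, h e)
  have hc₁ : ∀ e : ℕ × ℕ, e.2 < g → c e = c₁ e := fun e h1 => if_pos h1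
  have hc₂ : ∀ e : ℕ × ℕ, g ≤ e.2 ∧ g ≤ e.1 → c e = c₂ e := fun e h1 => by
    simp [c, h1.2, not_lt.2 h1.1]
  have hc₃ : ∀ e : ℕ × ℕ, g ≤ e.2 ∧ e.1 < g → c e = (γ, h e) := fun e h1 => by
    simp [c, not_le.2 h1.2, not_lt.2 h1.1]
  refine ⟨c, ?_, ?_, ?_⟩
  · intro e he h1 h2
    rcases hor e with h3 | h3 | h3
    · rw [hc₁ e h3]; exact hb₁ e he h1 h3
    · rw [hc₂ e h3]; exact hb₂ e he h3.2 h2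
    · rw [hc₃ e h3]; exact ⟨hγ, hh e he h3.2 h3.1⟩
  · intro e he e' he' h1 h2 h3 h4 h5 heq
    rcases hor e with h6 | h6 | h6 <;> rcases hor e' with h7 | h7 | h7
    · rw [hc₁ e h6, hc₁ e' h7] at heq
      exact hp₁ e he e' he' h1 h7 h3 h4 h5 heq
    · omega
    · rw [hc₁ e h6, hc₃ e' h7] at heq
      refine ho₁ e he h1 h6 e'.2 e'.1 (Or.inr h7.1) (Or.inr he') h3 h4 ?_
      rw [heq, hin _ (by omega) h2]
    · omega
    · rw [hc₂ e h6, hc₂ e' h7] at heq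
      exact hp₂ e he e' he' h6.2 h2 h3 h4 h5 heq
    · omega
    · omega
    · rw [hc₃ e h6, hc₂ e' h7] at heq
      refine ho₂ e' he' h7.2 h2 e.1 e.2 (Or.inl h6.2) (Or.inl he) h4 h5 ?_
      rw [← heq, hin _ h1 (by omega)]
    · rw [hc₃ e h6, hc₃ e' h7] at heq
      have := hlt e he e' he' h7.2 h6.1 h3 h5
      have := congrArg Prod.snd heq
      simp only at this
      omega
  · intro e he h1 h2 x y hx hxy h3 h4
    rcases hor e with h6 | h6 | h6
    · rw [hc₁ e h6, ← hout x hx]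
      exact ho₁ e he h1 h6 x y (by omega) hxy h3 h4
    · rw [hc₂ e h6, ← hout x hx]
      exact ho₂ e he h6.2 h2 x y (by omega) hxy h3 h4
    · rw [hc₃ e h6]
      exact (hun x ⟨hx, y, by omega, by omega, hxy⟩).symm

theorem Separated.recolour {F : Finset (ℕ × ℕ)} {ρ : ℕ → ℕ} {a b a' b' γ : ℕ}
    (hs : Separated F ρ a b) (hun : ∀ x, Sees F a b a b x → ρ x ≠ γ)
    (ha : a ≤ a') (hb : b' ≤ b) (hab : a' ≤ b') (hor : a' = a ∨ b' = b) :
    Separated F (recolour ρ a b γ) a' b' := by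
  have key : ∀ x, Sees F a' b' a' b' x →
      (_root_.recolour ρ a b γ x = γ ∧ a ≤ x ∧ x < b ∧ (x < a' ∨ b' ≤ x)) ∨
      (_root_.recolour ρ a b γ x = ρ x ∧ ρ x ≠ γ ∧ Sees F a b a b x ∧ (x < a ∨ b ≤ x)) := by
    rintro x ⟨h1, y, h2, h3, h4⟩
    by_cases h : a ≤ x ∧ x < b
    · exact Or.inl ⟨if_pos h, h.1, h.2, h1⟩
    · have hx : x < a ∨ b ≤ x := by omega
      have : Sees F a b a b x := ⟨hx, y, by omega, by omega, h4⟩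
      exact Or.inr ⟨if_neg h, hun x this, this, hx⟩
  intro x y x' y' hx hy hx' hy' h1 h2 h3 h4
  rcases key x hx with hx | hx <;> rcases key y hy with hy | hy <;>
    rcases key x' hx' with hx' | hx' <;> rcases key y' hy' with hy' | hy'
  all_goals try (exfalso; omega)
  · unfold CycBefore at *; omega
  · unfold CycBefore at *; omega
  · have := hs x y x' y' hx.2.2.1 hy.2.2.1 hx'.2.2.1 hy'.2.2.1 (by omega) (by omega) (by omega)
    unfold CycBefore at *; omega

theorem Concat.split {G : ℕ → ℕ → Prop} {m n : ℕ} : ∀ {a b : ℕ}, Concat G (m + n) a b →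
    ∃ g, a ≤ g ∧ g ≤ b ∧ Concat G m a g ∧ Concat G n g b := by
  have hle : ∀ n a b, Concat G n a b → a ≤ b := by
    intro n
    cases n with
    | zero => exact fun a b h => le_of_eq h
    | succ n => rintro a b ⟨g, h1, h2, -⟩; omega
  induction m with
  | zero =>
    intro a b h
    rw [Nat.zero_add] at h
    exact ⟨a, le_rfl, hle _ _ _ h, rfl, h⟩
  | succ m ih =>
    intro a b h
    rw [Nat.succ_add] at h
    obtain ⟨g, h1, h2, h3, h4⟩ := h
    obtain ⟨g', h5, h6, h7, h8⟩ := ih h4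
    exact ⟨g', by omega, h6, ⟨g, h1, h5, h3, h7⟩, h8⟩

theorem Concat.mono {G : ℕ → ℕ → Prop} (hG : ∀ a, G a a) {m n : ℕ} (hmn : m ≤ n) {a b : ℕ}
    (hab : a ≤ b) (h : Concat G m a b) : Concat G n a b := by
  induction n, hmn using Nat.le_induction with
  | base => exact h
  | succ n _ ih => exact ⟨a, le_rfl, hab, hG a, ih⟩

/-- Greedily, a block is a concatenation of few blocks satisfying `G`, or it contains
many consecutive blocks not satisfying `G`. -/
theorem concat_or_exists_monotone {G : ℕ → ℕ → Prop} (hG₀ : ∀ a, G a a)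
    (hG₁ : ∀ a, G a (a + 1)) (m : ℕ) : ∀ a b, a ≤ b → Concat G (2 * m + 1) a b ∨
      ∃ h : ℕ → ℕ, Monotone h ∧ h 0 = a ∧ h (m + 1) ≤ b ∧ ∀ j ≤ m, ¬ G (h j) (h (j + 1)) := by
  classical
  have step : ∀ a b, a ≤ b → G a b ∨ ∃ g, a ≤ g ∧ g + 1 ≤ b ∧ G a g ∧ ¬ G a (g + 1) := by
    intro a b hab
    induction b, hab using Nat.le_induction with
    | base => exact Or.inl (hG₀ a)
    | succ b hab ih =>
      rcases ih with h | ⟨g, h1, h2, h3⟩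
      · by_cases h' : G a (b + 1)
        · exact Or.inl h'
        · exact Or.inr ⟨b, hab, le_rfl, h, h'⟩
      · exact Or.inr ⟨g, h1, by omega, h3⟩
  have cons : ∀ (m a b g : ℕ) (h : ℕ → ℕ), Monotone h → a ≤ g → h 0 = g → h m ≤ b →
      (∀ j < m, ¬ G (h j) (h (j + 1))) → ¬ G a g →
      ∃ h : ℕ → ℕ, Monotone h ∧ h 0 = a ∧ h (m + 1) ≤ b ∧ ∀ j ≤ m, ¬ G (h j) (h (j + 1)) := by
    intro m a b g h hm h1 h2 h3 h4 h5
    refine ⟨fun j => Nat.casesOn j a h, monotone_nat_of_le_succ ?_, rfl, h3, ?_⟩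
    · rintro (_ | j)
      · simp; omega
      · exact hm (Nat.le_succ j)
    · rintro (_ | j) hj
      · simpa [h2] using h5
      · exact h4 j (by omega)
  induction m with
  | zero =>
    intro a b hab
    rcases step a b hab with h | ⟨g, h1, h2, h3, h4⟩
    · exact Or.inl ⟨b, hab, le_rfl, h, rfl⟩
    · exact Or.inr (cons 0 a b (g + 1) (fun _ => g + 1) monotone_const (by omega) rfl h2
        (by simp) h4)
  | succ m ih =>
    intro a b hab
    rcases step a b hab with h | ⟨g, h1, h2, h3, h4⟩
    · exact Or.inl (Concat.mono (m := 1) hG₀ (by omega) hab ⟨b, hab, le_rfl, h, rfl⟩)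
    · rcases ih (g + 1) b h2 with h | ⟨h, h5, h6, h7, h8⟩
      · exact Or.inl ⟨g, h1, by omega, h3, g + 1, by omega, h2, hG₁ g, h⟩
      · exact Or.inr (cons (m + 1) a b (g + 1) h h5 (by omega) h6 h7
          (fun j hj => h8 j (by omega)) h4)

/-- A Turán-type bound: few of the consecutive blocks inside `[a, b)` see many colours. -/
theorem mul_le_of_separated {F : Finset (ℕ × ℕ)} {k : ℕ} (hF : ∀ e ∈ F, e.1 < e.2)
    (hk : CliqueLE F k) {ρ : ℕ → ℕ} {a b d m : ℕ} (hs : Separated F ρ a b) {h : ℕ → ℕ} (hm : Monotone h) (ha : h 0 = a)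
    (hb : h m ≤ b) (hd : ∀ j < m, d ≤ (seenColours F ρ a b (h j) (h (j + 1))).card) :
    m * d ≤ k * ((seenColours F ρ a b a b).card + m) := by
  classical
  set X := seenColours F ρ a b a b with hX
  let R : ℕ → ℕ → Prop := fun χ χ' => χ ≠ χ' ∧ ∀ x x', Sees F a b a b x → Sees F a b a b x' →
    ρ x = χ → ρ x' = χ' → CycBefore a x x'
  have htot : ∀ χ ∈ X, ∀ χ' ∈ X, χ ≠ χ' → R χ χ' ∨ R χ' χ := by
    intro χ hχ χ' hχ' hne
    obtain ⟨x, hx, rfl⟩ := mem_seenColours.1 hχ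
    obtain ⟨x', hx', rfl⟩ := mem_seenColours.1 hχ'
    have hxx : x ≠ x' := fun h => hne (by rw [h])
    have : CycBefore a x x' ∨ CycBefore a x' x := by unfold CycBefore; omega
    rcases this with h1 | h1
    · exact Or.inl ⟨hne, fun y y' hy hy' h2 h3 =>
        hs x y x' y' hx hy hx' hy' h2.symm h3.symm hne h1⟩
    · exact Or.inr ⟨hne.symm, fun y' y hy' hy h2 h3 =>
        hs x' y' x y hx' hy' hx hy h2.symm h3.symm hne.symm h1⟩
  let r : ℕ → ℕ := fun χ => (X.filter fun χ' => R χ' χ).card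
  have hasymm : ∀ χ ∈ X, ∀ χ' ∈ X, R χ χ' → ¬ R χ' χ := by
    intro χ hχ χ' hχ' h1 h2
    obtain ⟨x, hx, rfl⟩ := mem_seenColours.1 hχ
    obtain ⟨x', hx', rfl⟩ := mem_seenColours.1 hχ'
    have h3 := h1.2 x x' hx hx' rfl rfl
    have h4 := h2.2 x' x hx' hx rfl rfl
    unfold CycBefore at h3 h4
    omega
  have htrans : ∀ χ ∈ X, ∀ χ' ∈ X, ∀ χ'' ∈ X, R χ χ' → R χ' χ'' → R χ χ'' := by
    intro χ hχ χ' hχ' χ'' hχ'' h1 h2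
    have hne : χ ≠ χ'' := by
      rintro rfl
      exact hasymm χ hχ χ' hχ' h1 h2
    obtain ⟨x', hx', rfl⟩ := mem_seenColours.1 hχ'
    refine ⟨hne, fun x x'' hx hx'' h3 h4 => ?_⟩
    have h5 := h1.2 x x' hx hx' h3 rfl
    have h6 := h2.2 x' x'' hx' hx'' rfl h4
    unfold CycBefore at *
    omega
  have hrlt : ∀ χ ∈ X, r χ < X.card := by
    intro χ hχ
    refine Finset.card_lt_card (Finset.filter_ssubset.2 ⟨χ, hχ, fun h => h.1 rfl⟩)
  have hrmono : ∀ χ ∈ X, ∀ χ' ∈ X, R χ χ' → r χ < r χ' := by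
    intro χ hχ χ' hχ' h1
    refine Finset.card_lt_card (Finset.ssubset_iff_of_subset ?_ |>.2
      ⟨χ, Finset.mem_filter.2 ⟨hχ, h1⟩, fun h => (Finset.mem_filter.1 h).2.1 rfl⟩)
    intro χ'' h2
    rw [Finset.mem_filter] at h2 ⊢
    exact ⟨h2.1, htrans _ h2.1 _ hχ _ hχ' h2.2 h1⟩
  have hsub : ∀ j < m, seenColours F ρ a b (h j) (h (j + 1)) ⊆ X := fun j hj =>
    seenColours_mono (ha ▸ hm (Nat.zero_le j)) ((hm (by omega)).trans hb)
  let Cells : Finset (Σ _ : ℕ, ℕ) :=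
    (Finset.range m).sigma fun j => seenColours F ρ a b (h j) (h (j + 1))
  have hcells : m * d ≤ Cells.card := by
    rw [Finset.card_sigma]
    calc m * d = ∑ _j ∈ Finset.range m, d := by simp
      _ ≤ _ := Finset.sum_le_sum fun j hj => hd j (Finset.mem_range.1 hj)
  have hmemCells : ∀ p ∈ Cells, p.1 < m ∧ p.2 ∈ seenColours F ρ a b (h p.1) (h (p.1 + 1)) := by
    intro p hp
    simpa [Cells] using hp
  have hwit : ∀ p : Σ _ : ℕ, ℕ, ∃ e : ℕ × ℕ, p ∈ Cells → e ∈ F ∧ ∃ x y, Sees F a b a b x ∧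
      ρ x = p.2 ∧ h p.1 ≤ y ∧ y < h (p.1 + 1) ∧ a ≤ y ∧ y < b ∧ (e = (x, y) ∨ e = (y, x)) := by
    intro p
    by_cases hp : p ∈ Cells
    · obtain ⟨h1, h2⟩ := hmemCells p hp
      obtain ⟨x, ⟨h3, y, h4, h5, h6⟩, h7⟩ := mem_seenColours.1 h2
      have h8 : a ≤ y := (ha ▸ hm (Nat.zero_le p.1)).trans h4
      have h9 : y < b := h5.trans_le ((hm (by omega)).trans hb)
      have h10 : Sees F a b a b x := ⟨h3, y, h8, h9, h6⟩
      rcases h6 with h6 | h6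
      · exact ⟨(x, y), fun _ => ⟨h6, x, y, h10, h7, h4, h5, h8, h9, Or.inl rfl⟩⟩
      · exact ⟨(y, x), fun _ => ⟨h6, x, y, h10, h7, h4, h5, h8, h9, Or.inr rfl⟩⟩
    · exact ⟨(0, 0), fun h => absurd h hp⟩
  choose w hw using hwit
  have hcross : ∀ p ∈ Cells, ∀ q ∈ Cells, p.1 < q.1 → R p.2 q.2 → Crosses id (w p) (w q) := by
    intro p hp q hq hpq hR
    obtain ⟨-, x, y, h1, h2, h3, h4, h5, h6, h7⟩ := hw p hp
    obtain ⟨-, x', y', h1', h2', h3', h4', h5', h6', h7'⟩ := hw q hq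
    have h8 := hR.2 x x' h1 h1' h2 h2'
    have h9 : h (p.1 + 1) ≤ h q.1 := hm hpq
    have h10 := h1.1
    have h10' := h1'.1
    have h11 := hF _ (hw p hp).1
    have h11' := hF _ (hw q hq).1
    unfold CycBefore at h8
    rcases h7 with h7 | h7 <;> rcases h7' with h7' | h7' <;> rw [h7] at h11 ⊢ <;>
      rw [h7'] at h11' ⊢ <;> simp only [Crosses, id] at h11 h11' ⊢ <;> omega
  let φ : (Σ _ : ℕ, ℕ) → ℕ := fun p => r p.2 + (m - 1 - p.1)
  have hX₂ : ∀ p ∈ Cells, p.2 ∈ X := fun p hp => hsub p.1 (hmemCells p hp).1 (hmemCells p hp).2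
  have hfib : ∀ p ∈ Cells, ∀ q ∈ Cells, φ p = φ q → p ≠ q →
      Crosses id (w p) (w q) := by
    intro p hp q hq hpq hne
    have h1 := (hmemCells p hp).1
    have h2 := (hmemCells q hq).1
    have h3 : r p.2 + (m - 1 - p.1) = r q.2 + (m - 1 - q.1) := hpq
    by_cases h4 : p.2 = q.2
    · rw [h4] at h3
      have h5 : p.1 = q.1 := by omega
      exact absurd (Sigma.ext h5 (heq_of_eq h4)) hne
    · rcases htot _ (hX₂ p hp) _ (hX₂ q hq) h4 with h5 | h5
      · have := hrmono _ (hX₂ p hp) _ (hX₂ q hq) h5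
        exact hcross p hp q hq (by omega) h5
      · have := hrmono _ (hX₂ q hq) _ (hX₂ p hp) h5
        exact (hcross q hq p hp (by omega) h5).symm
  have hmaps : ∀ p ∈ Cells, φ p ∈ Finset.range (X.card + m) := by
    intro p hp
    have h1 := (hmemCells p hp).1
    have h2 := hrlt _ (hX₂ p hp)
    rw [Finset.mem_range]
    change r p.2 + (m - 1 - p.1) < _
    omega
  have hcard := Finset.card_le_mul_card_image_of_maps_to hmaps k (by
    intro v _
    have hmem : ∀ p ∈ Cells.filter (φ · = v), p ∈ Cells ∧ φ p = v := fun p hp =>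
      Finset.mem_filter.1 hp
    rw [← Finset.card_image_of_injOn (f := w)]
    · refine hk _ ?_ ?_
      · intro e he
        obtain ⟨p, hp, rfl⟩ := Finset.mem_image.1 he
        exact (hw p (hmem p hp).1).1
      · intro e he e' he' hne
        obtain ⟨p, hp, rfl⟩ := Finset.mem_image.1 he
        obtain ⟨q, hq, rfl⟩ := Finset.mem_image.1 he'
        obtain ⟨hp, hp'⟩ := hmem p hp
        obtain ⟨hq, hq'⟩ := hmem q hq
        exact hfib p hp q hq (hp'.trans hq'.symm) fun h => hne (by rw [h])
    · intro p hp q hq hpq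
      obtain ⟨hp, hp'⟩ := hmem p hp
      obtain ⟨hq, hq'⟩ := hmem q hq
      by_contra hne
      have := hfib p hp q hq (hp'.trans hq'.symm) hne
      rw [hpq] at this
      unfold Crosses at this
      omega)
  rw [Finset.card_range] at hcard
  exact hcells.trans hcard

/-- Splitting a block into `2 ^ ℓ` smaller ones by a balanced binary tree, using one new
colour for each level of the tree. -/
theorem BlockColourable.of_concat {F : Finset (ℕ × ℕ)} {C k : ℕ} (hk : CliqueLE F k)
    {ρ₀ : ℕ → ℕ} {A B : ℕ} {Γ₀ : Finset ℕ} (hΓ₀ : ∀ γ ∈ Γ₀, γ < C) {G : ℕ → ℕ → Prop}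
    (leaf : ∀ ρ a b, A ≤ a → a ≤ b → b ≤ B → G a b → Separated F ρ a b →
      (∀ x, (x < a ∨ b ≤ x) → (ρ x = ρ₀ x ∧ (x < A ∨ B ≤ x)) ∨ ρ x ∈ Γ₀) →
      BlockColourable F C k ρ a b)
    (ℓ : ℕ) : ∀ (ρ : ℕ → ℕ) (a b : ℕ) (Γ : Finset ℕ), Γ ⊆ Γ₀ → Γ.card = ℓ →
      (∀ γ ∈ Γ, ∀ x, Sees F a b a b x → ρ x ≠ γ) → A ≤ a → a ≤ b → b ≤ B →
      Separated F ρ a b →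
      (∀ x, (x < a ∨ b ≤ x) → (ρ x = ρ₀ x ∧ (x < A ∨ B ≤ x)) ∨ ρ x ∈ Γ₀) →
      Concat G (2 ^ ℓ) a b → BlockColourable F C k ρ a b := by
  induction ℓ with
  | zero =>
    rintro ρ a b Γ - - - ha hab hb hs hρ ⟨g, h1, h2, h3, h4⟩
    obtain rfl : g = b := h4
    exact leaf ρ a g ha hab hb h3 hs hρ
  | succ ℓ ih =>
    intro ρ a b Γ hΓ hcard hun ha hab hb hs hρ hQ
    rw [pow_succ, mul_two] at hQ
    obtain ⟨g, h1, h2, h3, h4⟩ := hQ.split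
    obtain ⟨γ, hγ⟩ : Γ.Nonempty := Finset.card_pos.1 (by omega)
    have hunγ := hun γ hγ
    have hsplit : ∀ a' b', a ≤ a' → b' ≤ b → a' ≤ b' → (a' = a ∨ b' = b) →
        Concat G (2 ^ ℓ) a' b' → BlockColourable F C k (recolour ρ a b γ) a' b' := by
      intro a' b' ha' hb' hab' hor hQ'
      refine ih _ a' b' (Γ.erase γ) ((Finset.erase_subset _ _).trans hΓ)
        (by rw [Finset.card_erase_of_mem hγ]; omega) ?_ (by omega) hab' (by omega)
        (hs.recolour hunγ ha' hb' hab' hor) ?_ hQ'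
      · rintro γ' hγ' x ⟨h5, y, h6, h7, h8⟩
        rw [Finset.mem_erase] at hγ'
        unfold recolour
        split_ifs with h9
        · exact hγ'.1.symm
        · exact hun γ' hγ'.2 x ⟨by omega, y, by omega, by omega, h8⟩
      · intro x hx
        unfold recolour
        split_ifs with h9
        · exact Or.inr (hΓ hγ)
        · exact hρ x (by omega)
    exact BlockColourable.split hk (hΓ₀ γ (hΓ hγ)) hunγ h1 h2
      (hsplit a g le_rfl h2 h1 (Or.inl rfl) h3) (hsplit g b h1 le_rfl h2 (Or.inr rfl) h4)

theorem six_mul_sub_le_four_pow {k : ℕ} (hk : 0 < k) : 2 * (3 * k - 2) + 1 ≤ 2 ^ (2 * k) := by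
  rw [pow_mul]
  induction k, hk using Nat.le_induction with
  | base => norm_num
  | succ k hk ih =>
    rw [pow_succ]
    omega

theorem blockColourable_of_card_le {F : Finset (ℕ × ℕ)} {k : ℕ} (hF : ∀ e ∈ F, e.1 < e.2)
    (hk : CliqueLE F k) (hk₀ : 0 < k) (n : ℕ) : ∀ (ρ : ℕ → ℕ) (a b : ℕ), b - a ≤ n → a ≤ b →
      Separated F ρ a b → (seenColours F ρ a b a b).card ≤ 5 * k →
      BlockColourable F (7 * k) k ρ a b := by
  have hsmall : ∀ (ρ : ℕ → ℕ) (a b : ℕ), b ≤ a + 1 → BlockColourable F (7 * k) k ρ a b := by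
    intro ρ a b hab
    refine ⟨fun _ => (0, 0), fun e he h1 h2 => ?_, fun e he e' he' h1 h2 => ?_,
      fun e he h1 h2 => ?_⟩
    · have := hF e he
      omega
    · have := hF e he
      omega
    · have := hF e he
      omega
  induction n with
  | zero => exact fun ρ a b hn _ _ _ => hsmall ρ a b (by omega)
  | succ n ih =>
    intro ρ a b hn hab hs hcol
    by_cases hlen : b ≤ a + 1
    · exact hsmall ρ a b hlen
    set X := seenColours F ρ a b a b with hX
    obtain ⟨Γ, hΓ, hΓcard⟩ : ∃ Γ ⊆ Finset.range (7 * k) \ X, Γ.card = 2 * k := by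
      refine Finset.exists_subset_card_eq ?_
      have := Finset.le_card_sdiff X (Finset.range (7 * k))
      rw [Finset.card_range] at this
      omega
    let G : ℕ → ℕ → Prop := fun a' b' => b' ≤ a' + 1 ∨
      ((seenColours F ρ a b a' b').card ≤ 3 * k ∧ b' - a' < b - a)
    have hG₀ : ∀ a, G a a := fun a => Or.inl (by omega)
    have hG₁ : ∀ a, G a (a + 1) := fun a => Or.inl le_rfl
    have hconcat : Concat G (2 ^ (2 * k)) a b := by
      by_cases hX₃ : X.card ≤ 3 * k
      · have h2 : 2 ≤ 2 ^ (2 * k) := by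
          calc 2 = 2 ^ 1 := rfl
            _ ≤ _ := Nat.pow_le_pow_right (by norm_num) (by omega)
        refine Concat.mono hG₀ h2 hab ⟨a + 1, by omega, by omega, hG₁ a, b, by omega, le_rfl,
          Or.inr ⟨?_, by omega⟩, rfl⟩
        exact (Finset.card_le_card (seenColours_mono (by omega) le_rfl)).trans hX₃
      · rcases concat_or_exists_monotone hG₀ hG₁ (3 * k - 2) a b hab with h | ⟨h, h1, h2, h3, h4⟩
        · exact Concat.mono hG₀ (six_mul_sub_le_four_pow hk₀) hab h
        · exfalso
          have := mul_le_of_separated (d := 3 * k + 1) hF hk hs h1 h2 h3 (by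
            intro j hj
            have h5 : ¬ G (h j) (h (j + 1)) := h4 j (by omega)
            simp only [G, not_or, not_and] at h5
            by_contra h6
            have h7 := h5.2 (by omega)
            have h8 : a ≤ h j := h2 ▸ h1 (Nat.zero_le j)
            have h9 : h (j + 1) ≤ b := (h1 (by omega)).trans h3
            have h10 : h j = a := by omega
            have h11 : h (j + 1) = b := by omega
            rw [h10, h11, ← hX] at h6
            omega)
          rw [← hX] at this
          have h5 : 3 * k - 2 + 1 = 3 * k - 1 := by omega
          rw [h5] at this
          zify [show 1 ≤ 3 * k by omega] at this hcol hk₀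
          nlinarith
    refine BlockColourable.of_concat hk (ρ₀ := ρ) (A := a) (B := b) (Γ₀ := Γ)
      (fun γ hγ => ?_) ?_ (2 * k) ρ a b Γ subset_rfl hΓcard ?_ le_rfl hab le_rfl hs
      ?_ hconcat
    · simpa using (Finset.mem_sdiff.1 (hΓ hγ)).1
    · intro ρ' a' b' ha hab' hb hG hs' hρ'
      rcases hG with hG | ⟨hG, hlt⟩
      · exact hsmall ρ' a' b' hG
      · refine ih ρ' a' b' (by omega) hab' hs' ?_
        have hsub : seenColours F ρ' a' b' a' b' ⊆ seenColours F ρ a b a' b' ∪ Γ := by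
          intro γ hγ
          obtain ⟨x, hx, rfl⟩ := mem_seenColours.1 hγ
          rcases hρ' x hx.1 with ⟨h1, h2⟩ | h1
          · rw [h1]
            exact Finset.mem_union_left _ (mem_seenColours.2 ⟨x, ⟨h2, hx.2⟩, rfl⟩)
          · exact Finset.mem_union_right _ h1
        have h1 := Finset.card_le_card hsub
        have h2 := Finset.card_union_le (seenColours F ρ a b a' b') Γ
        omega
    · rintro γ hγ x hx rfl
      exact (Finset.mem_sdiff.1 (hΓ hγ)).2 (mem_seenColours.2 ⟨x, hx, rfl⟩)
    · exact fun x hx => Or.inl ⟨rfl, hx⟩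

/-- Pairwise crossing edges form a twist. -/
theorem TwistLE.cliqueLE {E : Finset (ℕ × ℕ)} {f : ℕ → ℕ} {k : ℕ} (hf : LinExt E f)
    (h : TwistLE E f k) : CliqueLE (E.image fun e => (f e.1, f e.2)) k := by
  classical
  intro A hA hcross
  have hinj : Set.InjOn Prod.fst (A : Set (ℕ × ℕ)) := by
    intro e he e' he' heq
    by_contra hne
    have := hcross e he e' he' hne
    simp only [Crosses, id] at this
    omega
  have hcard : (A.image Prod.fst).card = A.card := Finset.card_image_of_injOn hinj
  let p := (A.image Prod.fst).orderEmbOfFin hcard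
  have hex : ∀ i, ∃ e : ℕ × ℕ, e ∈ E ∧ (f e.1, f e.2) ∈ A ∧ f e.1 = p i := by
    intro i
    obtain ⟨e, he, hei⟩ := Finset.mem_image.1 ((A.image Prod.fst).orderEmbOfFin_mem hcard i)
    obtain ⟨e', he', rfl⟩ := Finset.mem_image.1 (hA he)
    exact ⟨e', he', he, hei⟩
  choose e heE heA hep using hex
  have hlt : ∀ i j, i < j → f (e i).1 < f (e j).1 ∧ f (e j).1 < f (e i).2 ∧
      f (e i).2 < f (e j).2 := by
    intro i j hij
    have h1 : p i < p j := p.strictMono hij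
    rw [← hep, ← hep] at h1
    have := hcross _ (heA i) _ (heA j) fun h2 => h1.ne (congrArg Prod.fst h2)
    simp only [Crosses, id] at this
    omega
  refine h A.card (fun i => (e i).1) (fun i => (e i).2) ⟨heE, fun i j hij => (hlt i j hij).1,
    fun i j hij => (hlt i j hij).2.2, fun i j => ?_⟩
  change f (e i).1 < f (e j).2
  rcases lt_trichotomy i j with hij | rfl | hij
  · have := hlt i j hij
    omega
  · exact hf.2 _ (heE i)
  · exact (hlt j i hij).2.1

/-- Any graph admitting a vertex order with no `(k+1)`-twist admits a stack
layout with at most `7 * k ^ 2` stacks under that same vertex order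
(Davies–McCarty). -/
theorem no_big_twist_implies_few_stacks (E : Finset (ℕ × ℕ)) (f : ℕ → ℕ)
    (k : ℕ) (hf : LinExt E f) (h : TwistLE E f k) :
    ∃ c : ℕ × ℕ → ℕ, (∀ e ∈ E, c e < 7 * k ^ 2) ∧ ValidStacks E f c := by
  classical
  rcases Nat.eq_zero_or_pos k with rfl | hk₀
  · have hE : ∀ e ∈ E, False := by
      intro e he
      have := h 1 (fun _ => e.1) (fun _ => e.2) ⟨fun _ => he, Subsingleton.strictMono _,
        Subsingleton.strictMono _, fun _ _ => hf.2 e he⟩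
      omega
    exact ⟨fun _ => 0, fun e he => (hE e he).elim, fun e he => (hE e he).elim⟩
  set F := E.image fun e => (f e.1, f e.2) with hFdef
  have hmem : ∀ e ∈ E, (f e.1, f e.2) ∈ F := fun e he => Finset.mem_image_of_mem _ he
  have hF : ∀ e ∈ F, e.1 < e.2 := by
    intro e he
    obtain ⟨e', he', rfl⟩ := Finset.mem_image.1 he
    exact hf.2 e' he'
  set N := F.sup Prod.snd + 1 with hN
  have hlt : ∀ e ∈ F, e.2 < N := fun e he => Nat.lt_succ_of_le (Finset.le_sup (f := Prod.snd) he)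
  have hsees : ∀ x, ¬ Sees F 0 N 0 N x := by
    rintro x ⟨h1, y, -, h2, h3 | h3⟩
    · have := hF _ h3
      simp only at this
      omega
    · have := hlt _ h3
      simp only at this
      omega
  obtain ⟨c, hb, hp, -⟩ := blockColourable_of_card_le hF (h.cliqueLE hf) hk₀ N id 0 N (by omega)
    (by omega) (fun x _ _ _ hx => (hsees x hx).elim) (by
      rw [Finset.eq_empty_of_forall_notMem (s := seenColours F id 0 N 0 N)]
      · simp
      · intro γ hγ
        obtain ⟨x, hx, -⟩ := mem_seenColours.1 hγ
        exact hsees x hx)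
  refine ⟨fun e => (c (f e.1, f e.2)).1 * k + (c (f e.1, f e.2)).2, fun e he => ?_,
    fun e he e' he' heq hc => ?_⟩
  · obtain ⟨h1, h2⟩ := hb _ (hmem e he) (Nat.zero_le _) (hlt _ (hmem e he))
    nlinarith
  · obtain ⟨h1, h2⟩ := hb _ (hmem e he) (Nat.zero_le _) (hlt _ (hmem e he))
    obtain ⟨h1', h2'⟩ := hb _ (hmem e' he') (Nat.zero_le _) (hlt _ (hmem e' he'))
    have hceq : c (f e.1, f e.2) = c (f e'.1, f e'.2) := by
      simp only at heq
      have hmod := congrArg (· % k) heq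
      have hdiv := congrArg (· / k) heq
      simp only [Nat.mul_comm _ k, Nat.mul_add_mod, Nat.mod_eq_of_lt h2,
        Nat.mod_eq_of_lt h2'] at hmod
      simp only [Nat.mul_comm _ k, Nat.mul_add_div hk₀, Nat.div_eq_of_lt h2,
        Nat.div_eq_of_lt h2', Nat.add_zero] at hdiv
      exact Prod.ext hdiv hmod
    rcases hc with ⟨h3, h4, h5⟩ | ⟨h3, h4, h5⟩
    · exact hp _ (hmem e he) _ (hmem e' he') (Nat.zero_le _) (hlt _ (hmem e' he')) h3 h4 h5 hceq
    · exact hp _ (hmem e' he') _ (hmem e he) (Nat.zero_le _) (hlt _ (hmem e he)) h3 h4 h5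
        hceq.symm
end
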